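/- Let H be a finite simple chordal graph with no K_{2,3} minor. Then for every pair of proper 5-colorings α' and β' of H there exists a transformation from α' to β' recoloring each vertex at most 692 times. -/

import Mathlib

open SimpleGraph

/-- A proper coloring of `G` with `ℓ` colors: adjacent vertices get distinct colors. -/
def IsProperColoring {V : Type} (G : SimpleGraph V) {ℓ : ℕ} (c : V → Fin ℓ) : Prop :=
  ∀ ⦃u v : V⦄, G.Adj u v → c u ≠ c v

/-- `c` is a transformation sequence from `α` to `β`: a sequence of proper colorings
starting at `α`, ending at `β`, in which consecutive colorings differ on exactly one vertex. -/
def IsTransformSeq {V : Type} (G : SimpleGraph V) {ℓ m : ℕ}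
    (c : Fin (m + 1) → V → Fin ℓ) (α β : V → Fin ℓ) : Prop :=
  c 0 = α ∧ c (Fin.last m) = β ∧ (∀ i, IsProperColoring G (c i)) ∧
    ∀ i : Fin m, ∃! v : V, c i.castSucc v ≠ c i.succ v

/-- The number of steps of the sequence `c` at which the vertex `v` is recolored. -/
def RecolorCount {V : Type} {ℓ m : ℕ} (c : Fin (m + 1) → V → Fin ℓ) (v : V) : ℕ :=
  (Finset.univ.filter fun i : Fin m => c i.castSucc v ≠ c i.succ v).card

/-- `H` is a minor of `G`: there are pairwise disjoint nonempty branch sets in `G`, each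
inducing a connected subgraph, with an edge of `G` between the branch sets of any two
vertices adjacent in `H`. -/
def IsMinor {W V : Type} (H : SimpleGraph W) (G : SimpleGraph V) : Prop :=
  ∃ B : W → Set V,
    (∀ h, (B h).Nonempty) ∧
    (Pairwise fun h h' => Disjoint (B h) (B h')) ∧
    (∀ h, (G.induce (B h)).Connected) ∧
    ∀ ⦃h h'⦄, H.Adj h h' → ∃ u ∈ B h, ∃ v ∈ B h', G.Adj u v

/-- Every edge of `G` lies on at most one cycle: two cycles sharing an edge have the
same edge set. -/
def EdgeOnAtMostOneCycle {V : Type} (G : SimpleGraph V) : Prop :=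
  ∀ (u v : V) (p : G.Walk u u) (q : G.Walk v v), p.IsCycle → q.IsCycle →
    ∀ e, e ∈ p.edges → e ∈ q.edges → ∀ e', (e' ∈ p.edges ↔ e' ∈ q.edges)

/-- A cactus graph: connected and every edge lies on at most one cycle. -/
def IsCactus {V : Type} (G : SimpleGraph V) : Prop :=
  G.Connected ∧ EdgeOnAtMostOneCycle G

/-- A chordal graph: every cycle of length at least `4` has a chord; equivalently,
there is no induced cycle of length at least `4`. -/
def IsChordal {V : Type} (G : SimpleGraph V) : Prop :=
  ∀ (v : V) (p : G.Walk v v), p.IsCycle → 4 ≤ p.length →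
    ∃ u w, u ∈ p.support ∧ w ∈ p.support ∧ G.Adj u w ∧ s(u, w) ∉ p.edges

/-- The sequence of successive colors taken by the vertex `v` along the sequence `c`
(its starting color followed by the new color at each of its recolorings). -/
def ColorTrace {V : Type} {ℓ m : ℕ} (c : Fin (m + 1) → V → Fin ℓ) (v : V) : List (Fin ℓ) :=
  (List.ofFn fun i : Fin (m + 1) => c i v).destutter (· ≠ ·)

namespace Recoloring

/-- A recoloring move: a vertex together with its new color. -/
abbrev Move (κ : Type) := κ × Fin 5

section Moves

variable {κ : Type} [DecidableEq κ]

/-- The coloring obtained from `s` by performing a list of moves. -/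
def run (s : κ → Fin 5) : List (Move κ) → κ → Fin 5
  | [] => s
  | m :: L => run (Function.update s m.1 m.2) L

/-- The successive colors given to `v` by a list of moves. -/
def trace (v : κ) (L : List (Move κ)) : List (Fin 5) :=
  (L.filter fun m => m.1 = v).map Prod.snd

theorem trace_cons (v : κ) (m : Move κ) (L : List (Move κ)) :
    trace v (m :: L) = if m.1 = v then m.2 :: trace v L else trace v L := by
  by_cases h : m.1 = v <;> simp [trace, h]

/-- Starting from `s`, every move uses a color that is currently absent from `C`. -/
def CliqueLegal (C : Set κ) : (κ → Fin 5) → List (Move κ) → Prop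
  | _, [] => True
  | s, m :: L => (∀ u ∈ C, s u ≠ m.2) ∧ CliqueLegal C (Function.update s m.1 m.2) L

/-- Boolean version of `CliqueLegal` for the vertices in a list. -/
def cliqueLegalB (us : List κ) : (κ → Fin 5) → List (Move κ) → Bool
  | _, [] => true
  | s, m :: L => us.all (fun u => !decide (s u = m.2)) &&
      cliqueLegalB us (Function.update s m.1 m.2) L

theorem cliqueLegalB_iff (us : List κ) (s : κ → Fin 5) (L : List (Move κ)) :
    cliqueLegalB us s L = true ↔ CliqueLegal {u | u ∈ us} s L := by
  induction L generalizing s with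
  | nil => simp [cliqueLegalB, CliqueLegal]
  | cons m L ih => simp [cliqueLegalB, CliqueLegal, ih]

/-- The obstruction to extending a list of moves on an edge from `i` (which may receive color `0`)
to `n` (which must avoid color `0` in the end) to a third vertex moving at most twice. -/
def bad (s : κ → Fin 5) (i n : κ) : List (Move κ) → Bool
  | [m₁, m₂, m₃, m₄] =>
      decide [s i, s n, m₁.2, m₂.2, m₃.2].Nodup &&
      decide [0, run s [m₁, m₂] i, run s [m₁, m₂] n, m₃.2, m₄.2].Nodup
  | _ => false

/-- All colors. -/
def colors : List (Fin 5) := [0, 1, 2, 3, 4]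

theorem mem_colors (c : Fin 5) : c ∈ colors := by
  revert c; decide

/-- Test all legal lists of at most `n` moves of the vertices in `vs`. -/
def enumAll (vs : List κ) (test : List (Move κ) → Bool) :
    ℕ → (κ → Fin 5) → List (Move κ) → Bool
  | 0, _, pre => test pre
  | n + 1, s, pre => test pre && vs.all fun v => colors.all fun c =>
      vs.any (fun u => decide (s u = c)) ||
        enumAll vs test n (Function.update s v c) (pre ++ [(v, c)])

theorem enumAll_sound {vs : List κ} {test : List (Move κ) → Bool} {n : ℕ} {s : κ → Fin 5}
    {pre W : List (Move κ)} (h : enumAll vs test n s pre = true) (hn : W.length ≤ n)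
    (hW : ∀ m ∈ W, m.1 ∈ vs) (hl : CliqueLegal {u | u ∈ vs} s W) : test (pre ++ W) = true := by
  induction W generalizing n s pre with
  | nil => cases n <;> simp_all [enumAll]
  | cons m W ih =>
    cases n with
    | zero => simp at hn
    | succ n =>
      simp only [enumAll, Bool.and_eq_true, List.all_eq_true, Bool.or_eq_true, List.any_eq_true,
        decide_eq_true_eq] at h
      rcases h.2 m.1 (hW m (by simp)) m.2 (mem_colors _) with ⟨u, hu, h'⟩ | h'
      · exact absurd h' (hl.1 u hu)
      · have := ih h' (by simpa using hn) (fun m' hm' => hW m' (by simp [hm'])) hl.2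
        simpa using this

/-- Search for a list of moves satisfying `P` which consists of the moves `W` and of moves of
the vertices in `free`, using at most `t` moves in total. -/
def search (us free : List κ) (cs : List (Fin 5)) (P : List (Move κ) → Bool) :
    ℕ → List (Move κ) → (κ → Fin 5) → List (Move κ) → Bool
  | 0, W, _, R => W.isEmpty && P R.reverse
  | t + 1, W, s, R =>
      (match W with
        | [] => P R.reverse
        | m :: W' => us.all (fun u => !decide (s u = m.2)) &&
            search us free cs P t W' (Function.update s m.1 m.2) (m :: R)) ||
      (decide (W.length ≤ t) && free.any fun v => cs.any fun c =>
        us.all (fun u => !decide (s u = c)) &&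
          search us free cs P t W (Function.update s v c) ((v, c) :: R))

theorem exists_of_search {us free : List κ} {cs : List (Fin 5)} {P : List (Move κ) → Bool}
    {t : ℕ} {W : List (Move κ)} {s : κ → Fin 5} {R : List (Move κ)}
    (h : search us free cs P t W s R = true) :
    ∃ R', P R' = true ∧ R'.length ≤ R.length + t := by
  induction t generalizing W s R with
  | zero => simp only [search, Bool.and_eq_true] at h; exact ⟨_, h.2, by simp⟩
  | succ t ih =>
    simp only [search, Bool.or_eq_true, Bool.and_eq_true, List.any_eq_true] at h
    rcases h with h | ⟨_, _, _, _, _, _, h⟩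
    · cases W with
      | nil => exact ⟨_, h, by simp⟩
      | cons m W =>
        simp only [Bool.and_eq_true] at h
        obtain ⟨R', h₁, h₂⟩ := ih h.2
        exact ⟨R', h₁, by simp at h₂; omega⟩
    · obtain ⟨R', h₁, h₂⟩ := ih h
      exact ⟨R', h₁, by simp at h₂; omega⟩

end Moves

/-- Condition on the color trace of a vertex with initial color `s` in the first phase. -/
def clearTrace (i : Bool) (s : Fin 5) (τ : List (Fin 5)) : Bool :=
  decide (τ.length ≤ 2) && (i || !decide (τ.getLastD s = 0))

/-- Condition on the color trace of a vertex with initial color `s` and final color `e` in the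
second phase. -/
def fixTrace (i : Bool) (s e : Fin 5) (τ : List (Fin 5)) : Bool :=
  if i then τ.isEmpty else decide (τ.length ≤ 3) && !decide (0 ∈ τ) && decide (τ.getLastD s = e)

/-- An injective coloring of `Fin k` using color `0` exactly at `j`. -/
def pattern {k : ℕ} (j : Option (Fin k)) (i : Fin k) : Fin 5 :=
  if j = some i then 0 else Fin.ofNat 5 (i + 1)

/-- The moves `W` satisfy the first phase condition at `v`. -/
def clearOk {k : ℕ} (i : Fin k → Bool) (s : Fin k → Fin 5) (W : List (Move (Fin k)))
    (v : Fin k) : Bool :=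
  clearTrace (i v) (s v) (trace v W)

/-- Can the moves `W` on the edge `01` be extended to the triangle `012`? -/
def triTest (i : Fin 3 → Bool) (s : Fin 3 → Fin 5) (W : List (Move (Fin 3))) : Bool :=
  !(clearOk i s W 0 && clearOk i s W 1 && !(i 0 && bad s 0 1 W)) ||
    search [0, 1, 2] [2] colors (fun R => (R.filter (fun m => !decide (m.1 = 2))) == W &&
      cliqueLegalB [0, 1, 2] s R && clearOk i s R 2 &&
      !(i 0 && bad s 0 2 (R.filter (fun m => !decide (m.1 = 1)))) &&
      !(i 2 && bad s 2 0 (R.filter (fun m => !decide (m.1 = 1)))) &&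
      !(i 2 && bad s 2 1 (R.filter (fun m => !decide (m.1 = 0))))) (W.length + 2) W s []

theorem tri0 : ∀ j : Option (Fin 3),
    enumAll [0, 1] (triTest (fun v => v = 0) (pattern j)) 4 (pattern j) [] = true := by
  decide +kernel

theorem tri2 : ∀ j : Option (Fin 3),
    enumAll [0, 1] (triTest (fun v => v = 2) (pattern j)) 4 (pattern j) [] = true := by
  decide +kernel

/-- Can the moves `W` of vertex `0` be extended to moves of all vertices? -/
def rootTest {k : ℕ} (us free : List (Fin k)) (cs : List (Fin 5)) (t : ℕ)
    (vt : Fin k → List (Fin 5) → Bool)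
    (s : Fin k → Fin 5) (r : Fin k) (W : List (Move (Fin k))) : Bool :=
  !(vt r (trace r W)) ||
    search us free cs (fun R => trace r R == trace r W && cliqueLegalB us s R &&
      us.all fun v => vt v (trace v R)) (W.length + t) W s []

theorem clearRoot_two : ∀ i ∈ [fun _ => false, fun v => decide (v = 0), fun v => decide (v = 1)],
    ∀ j : Option (Fin 2), enumAll [0] (rootTest [0, 1] [1] colors 1
      (fun v => clearTrace (i v) (pattern j v)) (pattern j) 0) 2 (pattern j) [] = true := by
  decide +kernel

theorem clearRoot_four : ∀ i ∈ [fun v => decide (v = 0), fun v => decide (v = 1)],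
    ∀ j : Option (Fin 4), enumAll [0] (rootTest [0, 1, 2, 3] [1, 2, 3] colors 4
      (fun v => clearTrace (i v) (pattern j v)) (pattern j) 0) 2 (pattern j) [] = true := by
  decide +kernel

theorem fixRoot_two : ∀ a b : Fin 5, [0, a, b].Nodup →
    enumAll [0] (rootTest [0, 1] [1] [1, 2, 3, 4] 3
      (fun v => fixTrace false (pattern none v) (![a, b] v)) (pattern none) 0) 3
      (pattern none) [] = true := by
  decide +kernel

theorem fixRoot_three : ∀ a b c : Fin 5, [0, a, b, c].Nodup →
    enumAll [0] (rootTest [0, 1, 2] [1, 2] [1, 2, 3, 4] 6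
      (fun v => fixTrace false (pattern none v) (![a, b, c] v)) (pattern none) 0) 3
      (pattern none) [] = true := by
  decide +kernel

section Transport

variable {κ ι : Type}

/-- Transport moves along a map of vertices and a permutation of the colors. -/
def mapMoves (e : κ → ι) (σ : Equiv.Perm (Fin 5)) (R : List (Move κ)) : List (Move ι) :=
  R.map (Prod.map e σ)

theorem filter_mapMoves {e : κ → ι} {σ : Equiv.Perm (Fin 5)} {p : Move ι → Bool}
    {q : Move κ → Bool} (h : ∀ m, p (Prod.map e σ m) = q m) (R : List (Move κ)) :
    (mapMoves e σ R).filter p = mapMoves e σ (R.filter q) := by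
  induction R with
  | nil => rfl
  | cons m R ih =>
    simp only [mapMoves, List.map_cons, List.filter_cons, h] at ih ⊢
    split <;> simp_all

/-- Moves of the image of `e` come from moves of the domain. -/
theorem exists_mapMoves_eq {e : κ → ι} (σ : Equiv.Perm (Fin 5)) {D : Set κ} {L : List (Move ι)}
    (hL : ∀ m ∈ L, m.1 ∈ e '' D) : ∃ W, mapMoves e σ W = L ∧ ∀ m ∈ W, m.1 ∈ D := by
  induction L with
  | nil => exact ⟨[], rfl, by simp⟩
  | cons m L ih =>
    obtain ⟨W, hW, hD⟩ := ih fun m' hm' => hL m' (by simp [hm'])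
    obtain ⟨u, hu, hm⟩ := hL m (by simp)
    refine ⟨(u, σ.symm m.2) :: W, ?_, ?_⟩
    · rw [← hW]; simp [mapMoves, hm]
    · simpa [hu] using hD

variable [DecidableEq κ] [DecidableEq ι]

theorem trace_mapMoves {e : κ → ι} (he : e.Injective) (σ : Equiv.Perm (Fin 5)) (v : κ)
    (R : List (Move κ)) : trace (e v) (mapMoves e σ R) = (trace v R).map σ := by
  rw [trace, filter_mapMoves (q := fun m => m.1 = v) (by simp [he.eq_iff])]
  simp [trace, mapMoves]

theorem update_comp_eq {e : κ → ι} (he : e.Injective) {σ : Equiv.Perm (Fin 5)} {s : κ → Fin 5}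
    {α : ι → Fin 5} (h : ∀ v, α (e v) = σ (s v)) (u : κ) (c : Fin 5) (v : κ) :
    Function.update α (e u) (σ c) (e v) = σ (Function.update s u c v) := by
  by_cases hv : v = u
  · subst hv; simp
  · rw [Function.update_of_ne (he.ne hv), Function.update_of_ne hv, h]

theorem run_mapMoves {e : κ → ι} (he : e.Injective) {σ : Equiv.Perm (Fin 5)} {s : κ → Fin 5}
    {α : ι → Fin 5} (h : ∀ v, α (e v) = σ (s v)) (R : List (Move κ)) (v : κ) :
    run α (mapMoves e σ R) (e v) = σ (run s R v) := by
  induction R generalizing α s with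
  | nil => exact h v
  | cons m R ih => exact ih (update_comp_eq he h m.1 m.2)

theorem cliqueLegal_mapMoves {e : κ → ι} (he : e.Injective) {σ : Equiv.Perm (Fin 5)}
    {s : κ → Fin 5} {α : ι → Fin 5} (h : ∀ v, α (e v) = σ (s v)) (D : Set κ)
    (R : List (Move κ)) : CliqueLegal (e '' D) α (mapMoves e σ R) ↔ CliqueLegal D s R := by
  induction R generalizing α s with
  | nil => simp [CliqueLegal, mapMoves]
  | cons m R ih =>
    have := ih (update_comp_eq he h m.1 m.2)
    simp only [mapMoves, List.map_cons, CliqueLegal, Set.forall_mem_image, Prod.map_fst,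
      Prod.map_snd, h, ne_eq, σ.injective.eq_iff] at this ⊢
    rw [this]

theorem bad_mapMoves {e : κ → ι} (he : e.Injective) {σ : Equiv.Perm (Fin 5)} (hσ : σ 0 = 0)
    {s : κ → Fin 5} {α : ι → Fin 5} (h : ∀ v, α (e v) = σ (s v)) (i n : κ)
    (R : List (Move κ)) : bad α (e i) (e n) (mapMoves e σ R) = bad s i n R := by
  match R with
  | [] | [_] | [_, _] | [_, _, _] | _ :: _ :: _ :: _ :: _ :: _ => rfl
  | [m₁, m₂, m₃, m₄] =>
    have h1 := run_mapMoves he h [m₁, m₂]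
    simp only [mapMoves, List.map_cons, List.map_nil] at h1
    have h2 (l : List (Fin 5)) : (l.map σ).Nodup ↔ l.Nodup := List.nodup_map_iff σ.injective
    have h3 := h2 [s i, s n, m₁.2, m₂.2, m₃.2]
    have h4 := h2 [0, run s [m₁, m₂] i, run s [m₁, m₂] n, m₃.2, m₄.2]
    simp only [List.map_cons, List.map_nil, hσ, ← h1, ← h] at h3 h4
    simp only [mapMoves, List.map_cons, List.map_nil, bad, Prod.map_snd, h3, h4]

theorem getLastD_map (σ : Fin 5 → Fin 5) (s : Fin 5) (τ : List (Fin 5)) :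
    (τ.map σ).getLastD (σ s) = σ (τ.getLastD s) := by
  rw [List.getLastD_eq_getLast?, List.getLastD_eq_getLast?, List.getLast?_map]
  cases τ.getLast? <;> rfl

theorem clearTrace_map {σ : Equiv.Perm (Fin 5)} (hσ : σ 0 = 0) (i : Bool) (s : Fin 5)
    (τ : List (Fin 5)) : clearTrace i (σ s) (τ.map σ) = clearTrace i s τ := by
  have (a : Fin 5) : σ a = 0 ↔ a = 0 := by rw [← hσ, σ.injective.eq_iff, hσ]
  simp [clearTrace, this]

theorem fixTrace_map {σ : Equiv.Perm (Fin 5)} (hσ : σ 0 = 0) (i : Bool) (s e : Fin 5)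
    (τ : List (Fin 5)) : fixTrace i (σ s) (σ e) (τ.map σ) = fixTrace i s e τ := by
  have h (a : Fin 5) : σ a = 0 ↔ a = 0 := by rw [← hσ, σ.injective.eq_iff, hσ]
  have h' : 0 ∈ τ.map σ ↔ 0 ∈ τ := by simp [h]
  simp only [fixTrace, getLastD_map, σ.injective.eq_iff, h', List.length_map, List.isEmpty_map]

theorem exists_perm_comp {k : ℕ} {p q : Fin k → Fin 5} (hp : p.Injective) (hq : q.Injective) :
    ∃ σ : Equiv.Perm (Fin 5), ∀ v, q v = σ (p v) := by
  obtain ⟨σ, h⟩ := (Equiv.Perm.isMultiplyPretransitive (Fin 5) k).exists_smul_eq ⟨p, hp⟩ ⟨q, hq⟩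
  exact ⟨σ, fun v => (DFunLike.congr_fun h v).symm⟩

theorem pattern_injective {k : ℕ} (hk : k ≤ 4) (j : Option (Fin k)) :
    (pattern j).Injective := by
  intro a b h
  simp only [pattern] at h
  split_ifs at h with ha hb hb
  · simpa [ha] using hb
  · simp [Fin.ext_iff] at h; omega
  · simp [Fin.ext_iff] at h; omega
  · simp [Fin.ext_iff] at h; omega

theorem exists_pattern {k : ℕ} (hk : k ≤ 4) {s : Fin k → Fin 5} (hs : s.Injective) :
    ∃ (j : Option (Fin k)) (σ : Equiv.Perm (Fin 5)), σ 0 = 0 ∧ (∀ v, s v = σ (pattern j v)) ∧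
      ((∀ v, s v ≠ 0) → j = none) := by
  by_cases h : ∃ i, s i = 0
  · obtain ⟨i, hi⟩ := h
    obtain ⟨σ, hσ⟩ := exists_perm_comp (pattern_injective hk (some i)) hs
    refine ⟨some i, σ, ?_, hσ, fun h => absurd hi (h i)⟩
    have := hσ i
    simpa [pattern, hi] using this.symm
  · push Not at h
    have hp : (Fin.cons 0 (pattern none) : Fin (k + 1) → Fin 5).Injective := by
      rw [Fin.cons_injective_iff]
      refine ⟨?_, pattern_injective hk none⟩
      rintro ⟨v, hv⟩
      simp [pattern, Fin.ext_iff] at hv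
      omega
    have hq : (Fin.cons 0 s : Fin (k + 1) → Fin 5).Injective := by
      rw [Fin.cons_injective_iff]
      exact ⟨by simpa using h, hs⟩
    obtain ⟨σ, hσ⟩ := exists_perm_comp hp hq
    exact ⟨none, σ, by simpa using (hσ 0).symm, fun v => by simpa using hσ v.succ, fun _ => rfl⟩

theorem length_le_of_trace (L : List (Move κ)) (u w : κ) (h : ∀ m ∈ L, m.1 = u ∨ m.1 = w) :
    L.length ≤ (trace u L).length + (trace w L).length := by
  induction L with
  | nil => simp
  | cons m L ih =>
    have := ih fun m' hm' => h m' (by simp [hm'])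
    rw [trace_cons, trace_cons, List.length_cons]
    rcases h m (by simp) with h | h <;> simp only [h, if_true, List.length_cons] <;>
      split <;> simp <;> omega

end Transport

section Roots

theorem CliqueLegal.filter {V : Type} [DecidableEq V] {C : Set V} {s s' : V → Fin 5}
    {L : List (Move V)} (h : CliqueLegal C s L) {D : Set V} (hDC : D ⊆ C)
    {p : Move V → Bool} (hp : ∀ m, m.1 ∈ D → p m = true)
    (hs : ∀ v ∈ D, s v = s' v) : CliqueLegal D s' (L.filter p) := by
  induction L generalizing s s' with
  | nil => trivial
  | cons m L ih =>
    rw [List.filter_cons]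
    split
    · refine ⟨fun u hu => hs u hu ▸ h.1 u (hDC hu), ih h.2 fun v hv => ?_⟩
      by_cases hvm : v = m.1
      · subst hvm; simp
      · simp [hvm, hs v hv]
    · next hm =>
      refine ih h.2 fun v hv => ?_
      have : v ≠ m.1 := by rintro rfl; exact hm (hp _ hv)
      simp [this, hs v hv]

variable {V : Type} [DecidableEq V]

/-- The moves of the single vertex `v` with color trace `τ`. -/
def movesOf (v : V) (τ : List (Fin 5)) : List (Move V) := τ.map fun c => (v, c)

theorem trace_movesOf (v : V) (τ : List (Fin 5)) : trace v (movesOf v τ) = τ := by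
  induction τ with
  | nil => rfl
  | cons c τ ih => simpa [movesOf, trace_cons] using ih

theorem movesOf_trace (v : V) (L : List (Move V)) :
    movesOf v (trace v L) = L.filter fun m => m.1 = v := by
  induction L with
  | nil => rfl
  | cons m L ih =>
    rw [trace_cons, List.filter_cons]
    by_cases h : m.1 = v
    · subst h; simpa [movesOf] using ih
    · simpa [h] using ih

theorem CliqueLegal.movesOf_trace {C : Set V} {s : V → Fin 5} {L : List (Move V)}
    (h : CliqueLegal C s L) {v : V} (hv : v ∈ C) :
    CliqueLegal {v} s (movesOf v (trace v L)) := by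
  rw [Recoloring.movesOf_trace]
  exact h.filter (by simpa using hv) (by simp) fun _ _ => rfl

theorem exists_root {k n t : ℕ} {us free : List (Fin (k + 1))} {cs : List (Fin 5)}
    {vt' : Fin (k + 1) → List (Fin 5) → Bool} {s : Fin (k + 1) → Fin 5} (hus : ∀ v, v ∈ us)
    (h : enumAll [0] (rootTest us free cs t vt' s 0) n s [] = true)
    {e : Fin (k + 1) → V} (he : e.Injective) {σ : Equiv.Perm (Fin 5)} {α : V → Fin 5}
    (hα : ∀ v, α (e v) = σ (s v)) {vt : V → List (Fin 5) → Bool}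
    (hvt : ∀ v τ, vt (e v) (τ.map σ) = vt' v τ) {τ : List (Fin 5)} (hτ : vt (e 0) τ = true)
    (hn : τ.length ≤ n) (hl : CliqueLegal {e 0} α (movesOf (e 0) τ)) :
    ∃ R, (∀ m ∈ R, m.1 ∈ Set.range e) ∧ CliqueLegal (Set.range e) α R ∧
      (∀ v ∈ Set.range e, vt v (trace v R) = true) ∧ trace (e 0) R = τ ∧ R.length ≤ n + t := by
  obtain ⟨W, hW, hW0⟩ := exists_mapMoves_eq (e := e) σ (D := {0}) (L := movesOf (e 0) τ)
    (by simp [movesOf])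
  have hlen : W.length ≤ n := by
    have := congrArg List.length hW
    simp [mapMoves, movesOf] at this
    omega
  have htr : (trace 0 W).map σ = τ := by
    rw [← trace_mapMoves he, hW, trace_movesOf]
  have hlW : CliqueLegal {u | u ∈ [(0 : Fin (k + 1))]} s W := by
    have : {u | u ∈ [(0 : Fin (k + 1))]} = {0} := by ext; simp
    rw [this, ← cliqueLegal_mapMoves he hα, hW, Set.image_singleton]
    exact hl
  have := enumAll_sound h hlen (by simpa using hW0) hlW
  rw [List.nil_append, rootTest, Bool.or_eq_true, ← hvt, htr, hτ] at this
  obtain ⟨R, hR, hRl⟩ := exists_of_search (by simpa using this)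
  simp only [Bool.and_eq_true, beq_iff_eq, cliqueLegalB_iff, List.all_eq_true] at hR
  refine ⟨mapMoves e σ R, ?_, ?_, ?_, ?_, ?_⟩
  · intro m hm
    obtain ⟨m', -, rfl⟩ := List.mem_map.1 hm
    exact ⟨m'.1, rfl⟩
  · rw [← Set.image_univ, cliqueLegal_mapMoves he hα]
    convert hR.1.2
    ext; simp [hus]
  · rintro _ ⟨v, rfl⟩
    rw [trace_mapMoves he, hvt]
    exact hR.2 v (hus v)
  · rw [trace_mapMoves he, hR.1.1, htr]
  · simp [mapMoves] at hRl ⊢; omega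

/-- The condition on the moves within a clique `C` in the first phase. -/
def ClearOk (I : V → Bool) (α : V → Fin 5) (C : Set V) (R : List (Move V)) : Prop :=
  (∀ m ∈ R, m.1 ∈ C) ∧ CliqueLegal C α R ∧
    (∀ v ∈ C, clearTrace (I v) (α v) (trace v R) = true) ∧
    ∀ u w, C = {u, w} → I u = true → I w = false → bad α u w R = false

theorem clearTrace_length {i : Bool} {s : Fin 5} {τ : List (Fin 5)}
    (h : clearTrace i s τ = true) : τ.length ≤ 2 := by
  simp only [clearTrace, Bool.and_eq_true, decide_eq_true_eq] at h
  exact h.1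

theorem fixTrace_length {i : Bool} {s e : Fin 5} {τ : List (Fin 5)}
    (h : fixTrace i s e τ = true) : τ.length ≤ 3 := by
  unfold fixTrace at h
  split at h <;> simp_all

theorem bad_of_length {s : V → Fin 5} {i n : V} {R : List (Move V)} (h : R.length ≤ 3) :
    bad s i n R = false := by
  match R with
  | [] | [_] | [_, _] | [_, _, _] => rfl
  | _ :: _ :: _ :: _ :: _ => simp at h; omega

variable {I : V → Bool} {α : V → Fin 5}

theorem exists_clearOk_singleton {v : V} {τ : List (Fin 5)}
    (hτ : clearTrace (I v) (α v) τ = true) (hl : CliqueLegal {v} α (movesOf v τ)) :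
    ∃ R, ClearOk I α {v} R ∧ trace v R = τ := by
  refine ⟨movesOf v τ, ⟨by simp [movesOf], hl, ?_, ?_⟩, trace_movesOf v τ⟩
  · rintro _ rfl
    rwa [trace_movesOf]
  · intro u w h hu hw
    have h1 : u = v := by have : u ∈ ({v} : Set V) := h ▸ (by simp); simpa using this
    have h2 : w = v := by have : w ∈ ({v} : Set V) := h ▸ (by simp); simpa using this
    rw [h1] at hu; rw [h2, hu] at hw; cases hw

theorem exists_clearOk_pair {u v : V} (huv : u ≠ v) (hα : α u ≠ α v)
    (hI : ¬(I u = true ∧ I v = true)) {τ : List (Fin 5)}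
    (hτ : clearTrace (I u) (α u) τ = true) (hl : CliqueLegal {u} α (movesOf u τ)) :
    ∃ R, ClearOk I α {u, v} R ∧ trace u R = τ := by
  have he : (![u, v]).Injective := by
    simp [Function.Injective, Fin.forall_fin_two, huv, huv.symm]
  have hs : (α ∘ ![u, v]).Injective := by
    simp [Function.Injective, Fin.forall_fin_two, hα, hα.symm]
  obtain ⟨j, σ, hσ, hj, -⟩ := exists_pattern (by norm_num) hs
  have hi : I ∘ ![u, v] ∈ [fun _ => false, fun v => decide (v = 0), fun v => decide (v = 1)] := by
    have key : ∀ i : Fin 2 → Bool, ¬ (i 0 = true ∧ i 1 = true) →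
      i ∈ [fun _ => false, fun v => decide (v = 0), fun v => decide (v = 1)] := by decide
    exact key _ hI
  obtain ⟨R, h1, h2, h3, h4, h5⟩ := exists_root (by decide) (clearRoot_two _ hi j) he hj
    (vt := fun v => clearTrace (I v) (α v))
    (by
      intro a τ
      rw [show α (![u, v] a) = _ from hj a, clearTrace_map hσ]; rfl) hτ (clearTrace_length hτ) hl
  have hr : Set.range ![u, v] = {u, v} := by ext; simp [eq_comm, or_comm]
  rw [hr] at h1 h2 h3
  exact ⟨R, ⟨h1, h2, h3, fun _ _ _ _ _ => bad_of_length h5⟩, h4⟩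

theorem exists_clearOk_four {e : Fin 4 → V} (he : e.Injective) (hα : (α ∘ e).Injective)
    {i : Fin 4} (hI : ∀ a, I (e a) = decide (a = i)) {v : V} (hv : v ∈ Set.range e)
    {τ : List (Fin 5)} (hτ : clearTrace (I v) (α v) τ = true)
    (hl : CliqueLegal {v} α (movesOf v τ)) :
    ∃ R, ClearOk I α (Set.range e) R ∧ trace v R = τ := by
  obtain ⟨r, rfl⟩ := hv
  have key : ∀ r i : Fin 4, ∃ π : Equiv.Perm (Fin 4), π 0 = r ∧
      (fun a => decide (π a = i)) ∈
        [fun v => decide (v = (0 : Fin 4)), fun v => decide (v = (1 : Fin 4))] := by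
    intro r i
    by_cases h : i = r
    · refine ⟨Equiv.swap 0 r, by simp, ?_⟩
      have : (fun a => decide (Equiv.swap 0 r a = i)) = fun v => decide (v = 0) := by
        ext a
        rw [decide_eq_decide.2]
        rw [Equiv.swap_apply_eq_iff, h, Equiv.swap_apply_right]
      simp [this]
    · have : ∃ π : Equiv.Perm (Fin 4), π 0 = r ∧ π 1 = i := by
        obtain ⟨σ, h⟩ := (Equiv.Perm.isMultiplyPretransitive (Fin 4) 2).exists_smul_eq
          ⟨![0, 1], by decide⟩ ⟨![r, i], by
            simp [Function.Injective, Fin.forall_fin_two, h, Ne.symm h]⟩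
        exact ⟨σ, DFunLike.congr_fun h 0, DFunLike.congr_fun h 1⟩
      obtain ⟨π, h0, h1⟩ := this
      refine ⟨π, h0, ?_⟩
      have : (fun a => decide (π a = i)) = fun v => decide (v = 1) := by
        ext a
        rw [decide_eq_decide.2]
        rw [← h1, π.injective.eq_iff]
      simp [this]
  obtain ⟨π, h0, hπ⟩ := key r i
  have hr : Set.range (e ∘ π) = Set.range e := π.surjective.range_comp e
  obtain ⟨j, σ, hσ, hj, -⟩ := exists_pattern (s := α ∘ e ∘ π) (by norm_num)
    (hα.comp π.injective)
  subst h0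
  have hi : I ∘ e ∘ π = fun a => decide (π a = i) := by ext a; simp [hI]
  rw [← hi] at hπ
  obtain ⟨R, h1, h2, h3, h4, h5⟩ := exists_root (by decide) (clearRoot_four _ hπ j)
    (he.comp π.injective) hj (vt := fun v => clearTrace (I v) (α v))
    (by
      intro a τ
      rw [show α ((e ∘ π) a) = _ from hj a, clearTrace_map hσ]; rfl) hτ (clearTrace_length hτ) hl
  rw [hr] at h1 h2 h3
  refine ⟨R, ⟨h1, h2, h3, fun u w huw => ?_⟩, h4⟩
  have c1 := Set.ncard_range_of_injective he
  have c2 := Set.ncard_insert_le u {w}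
  rw [← huw, c1] at c2
  simp at c2

/-- The condition on the moves within a clique `C` in the second phase. -/
def FixOk (I : V → Bool) (α β : V → Fin 5) (C : Set V) (R : List (Move V)) : Prop :=
  (∀ m ∈ R, m.1 ∈ C) ∧ CliqueLegal C α R ∧
    (∀ v ∈ C, fixTrace (I v) (α v) (β v) (trace v R) = true)

theorem exists_fixOk_singleton {β : V → Fin 5} {v : V} {τ : List (Fin 5)}
    (hτ : fixTrace (I v) (α v) (β v) τ = true) (hl : CliqueLegal {v} α (movesOf v τ)) :
    ∃ R, FixOk I α β {v} R ∧ trace v R = τ := by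
  refine ⟨movesOf v τ, ⟨by simp [movesOf], hl, ?_⟩, trace_movesOf v τ⟩
  rintro _ rfl
  rwa [trace_movesOf]

theorem exists_fixOk_pair {β : V → Fin 5} {u v : V} (huv : u ≠ v) (hα : α u ≠ α v)
    (hβ : β u ≠ β v) (hI : I u = false ∧ I v = false) (hα0 : α u ≠ 0 ∧ α v ≠ 0)
    (hβ0 : β u ≠ 0 ∧ β v ≠ 0) {τ : List (Fin 5)}
    (hτ : fixTrace (I u) (α u) (β u) τ = true) (hl : CliqueLegal {u} α (movesOf u τ)) :
    ∃ R, FixOk I α β {u, v} R ∧ trace u R = τ := by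
  have he : (![u, v]).Injective := by
    simp [Function.Injective, Fin.forall_fin_two, huv, huv.symm]
  have hs : (α ∘ ![u, v]).Injective := by
    simp [Function.Injective, Fin.forall_fin_two, hα, hα.symm]
  obtain ⟨j, σ, hσ, hj, hn⟩ := exists_pattern (by norm_num) hs
  obtain rfl : j = none := hn (by simp [Fin.forall_fin_two, hα0])
  have hσ' : σ.symm 0 = 0 := by rw [Equiv.symm_apply_eq, hσ]
  have hab : [0, σ.symm (β u), σ.symm (β v)].Nodup := by
    have := (List.nodup_map_iff σ.symm.injective (l := [0, β u, β v])).2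
      (by simp [hβ0.1.symm, hβ0.2.symm, hβ])
    simpa only [List.map_cons, List.map_nil, hσ'] using this
  obtain ⟨R, h1, h2, h3, h4, h5⟩ := exists_root (by decide) (fixRoot_two _ _ hab) he hj
    (vt := fun v => fixTrace (I v) (α v) (β v))
    (by
      intro a τ
      rw [← fixTrace_map hσ _ (pattern none a), ← hj]
      fin_cases a <;> simp [hI]) hτ (fixTrace_length hτ) hl
  have hr : Set.range ![u, v] = {u, v} := by ext; simp [eq_comm, or_comm]
  rw [hr] at h1 h2 h3
  exact ⟨R, ⟨h1, h2, h3⟩, h4⟩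

theorem exists_fixOk_triple {β : V → Fin 5} {e : Fin 3 → V} (he : e.Injective)
    (hα : (α ∘ e).Injective) (hβ : (β ∘ e).Injective) (hI : ∀ a, I (e a) = false)
    (hα0 : ∀ a, α (e a) ≠ 0) (hβ0 : ∀ a, β (e a) ≠ 0) {v : V} (hv : v ∈ Set.range e)
    {τ : List (Fin 5)} (hτ : fixTrace (I v) (α v) (β v) τ = true)
    (hl : CliqueLegal {v} α (movesOf v τ)) :
    ∃ R, FixOk I α β (Set.range e) R ∧ trace v R = τ := by
  obtain ⟨r, rfl⟩ := hv
  set π : Equiv.Perm (Fin 3) := Equiv.swap 0 r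
  have h0 : π 0 = r := Equiv.swap_apply_left 0 r
  clear_value π
  subst h0
  obtain ⟨j, σ, hσ, hj, hn⟩ := exists_pattern (s := α ∘ e ∘ π) (by norm_num)
    (hα.comp π.injective)
  obtain rfl : j = none := hn fun a => hα0 _
  have hσ' : σ.symm 0 = 0 := by rw [Equiv.symm_apply_eq, hσ]
  have hab : [0, σ.symm (β (e (π 0))), σ.symm (β (e (π 1))), σ.symm (β (e (π 2)))].Nodup := by
    have hinj := hβ.comp π.injective
    have h01 := hinj.ne (show (0 : Fin 3) ≠ 1 by decide)
    have h02 := hinj.ne (show (0 : Fin 3) ≠ 2 by decide)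
    have h12 := hinj.ne (show (1 : Fin 3) ≠ 2 by decide)
    have := (List.nodup_map_iff σ.symm.injective
      (l := [0, β (e (π 0)), β (e (π 1)), β (e (π 2))])).2
      (by simp_all [(hβ0 _).symm])
    simpa only [List.map_cons, List.map_nil, hσ'] using this
  obtain ⟨R, h1, h2, h3, h4, h5⟩ := exists_root (by decide) (fixRoot_three _ _ _ hab)
    (he.comp π.injective) hj (vt := fun v => fixTrace (I v) (α v) (β v))
    (by
      intro a τ
      rw [← fixTrace_map hσ _ (pattern none a), ← hj]
      fin_cases a <;> simp [hI]) hτ (fixTrace_length hτ) hl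
  rw [show Set.range (e ∘ π) = Set.range e from π.surjective.range_comp e] at h1 h2 h3
  exact ⟨R, ⟨h1, h2, h3⟩, h4⟩

end Roots

section Triangle

variable {V : Type} [DecidableEq V] {I : V → Bool} {α : V → Fin 5}

/-- Extension of the moves of an edge to a triangle, with indices. -/
theorem exists_triangle_extension_aux {i : Fin 3 → Bool}
    (h : ∀ j : Option (Fin 3), enumAll [0, 1] (triTest i (pattern j)) 4 (pattern j) [] = true)
    {e : Fin 3 → V} (he : e.Injective) (hα : (α ∘ e).Injective) (hI : ∀ a, I (e a) = i a)
    {L : List (Move V)} (hL : ∀ m ∈ L, m.1 = e 0 ∨ m.1 = e 1)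
    (hl : CliqueLegal {e 0, e 1} α L)
    (h0 : clearTrace (I (e 0)) (α (e 0)) (trace (e 0) L) = true)
    (h1 : clearTrace (I (e 1)) (α (e 1)) (trace (e 1) L) = true)
    (hb : I (e 0) = true → bad α (e 0) (e 1) L = false) :
    ∃ R, (∀ m ∈ R, m.1 ∈ Set.range e) ∧ CliqueLegal (Set.range e) α R ∧
      (R.filter fun m => !decide (m.1 = e 2)) = L ∧
      clearTrace (I (e 2)) (α (e 2)) (trace (e 2) R) = true ∧
      (I (e 0) = true →
        bad α (e 0) (e 2) (R.filter fun m => !decide (m.1 = e 1)) = false) ∧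
      (I (e 2) = true →
        bad α (e 2) (e 0) (R.filter fun m => !decide (m.1 = e 1)) = false) ∧
      (I (e 2) = true →
        bad α (e 2) (e 1) (R.filter fun m => !decide (m.1 = e 0)) = false) := by
  obtain ⟨j, σ, hσ, hj, -⟩ := exists_pattern (by norm_num) hα
  obtain ⟨W, rfl, hW⟩ := exists_mapMoves_eq (e := e) σ (D := {0, 1}) (L := L)
    (by simpa [Set.image_pair] using hL)
  have hj' (a) : α (e a) = σ (pattern j a) := hj a
  have hct (a R) : clearTrace (I (e a)) (α (e a)) (trace (e a) (mapMoves e σ R)) =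
      clearOk i (pattern j) R a := by
    rw [trace_mapMoves he, hj', clearTrace_map hσ, hI, clearOk]
  have hset : {u | u ∈ [(0 : Fin 3), 1]} = {0, 1} := by ext; simp
  have huniv : {u | u ∈ [(0 : Fin 3), 1, 2]} = Set.univ := by
    ext a; revert a; simp; decide
  rw [hct] at h0 h1
  rw [bad_mapMoves he hσ hj', hI] at hb
  have hlW : CliqueLegal {u | u ∈ [(0 : Fin 3), 1]} (pattern j) W := by
    rwa [hset, ← cliqueLegal_mapMoves he hj', Set.image_pair]
  have hlen : W.length ≤ 4 := by
    have := length_le_of_trace W 0 1 hW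
    have := clearTrace_length h0
    have := clearTrace_length h1
    omega
  have := enumAll_sound (h j) hlen (by simpa using hW) hlW
  rw [List.nil_append, triTest, h0, h1, Bool.or_eq_true] at this
  have hb' : (i 0 && bad (pattern j) 0 1 W) = false := by
    cases hi0 : i 0 <;> simp_all
  rw [hb'] at this
  obtain ⟨R, hR, -⟩ := exists_of_search (by simpa using this)
  simp only [Bool.and_eq_true, beq_iff_eq, cliqueLegalB_iff, huniv] at hR
  obtain ⟨⟨⟨⟨⟨hRW, hRl⟩, hR2⟩, hb1⟩, hb2⟩, hb3⟩ := hR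
  have hfil (a : Fin 3) : (mapMoves e σ R).filter (fun m => !decide (m.1 = e a)) =
      mapMoves e σ (R.filter fun m => !decide (m.1 = a)) :=
    filter_mapMoves (by simp [he.eq_iff]) R
  refine ⟨mapMoves e σ R, ?_, ?_, ?_, ?_, ?_, ?_, ?_⟩
  · intro m hm
    obtain ⟨m', -, rfl⟩ := List.mem_map.1 hm
    exact ⟨m'.1, rfl⟩
  · rw [← Set.image_univ, cliqueLegal_mapMoves he hj']
    exact hRl
  · rw [hfil, hRW]
  · rw [hct, hR2]
  all_goals
    intro h
    rw [hI] at h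
    rw [hfil, bad_mapMoves he hσ hj']
    simp_all

theorem exists_triangle_extension {a b v : V} (hab : a ≠ b) (hav : a ≠ v) (hbv : b ≠ v)
    (ab : α a ≠ α b) (av : α a ≠ α v) (bv : α b ≠ α v)
    (hI : (I a = true ∧ I b = false ∧ I v = false) ∨ (I a = false ∧ I b = true ∧ I v = false) ∨
      (I a = false ∧ I b = false ∧ I v = true)) {L : List (Move V)}
    (hL : ClearOk I α {a, b} L) :
    ∃ R : List (Move V), (∀ m ∈ R, m.1 = a ∨ m.1 = b ∨ m.1 = v) ∧
      (R.filter fun m => !decide (m.1 = v)) = L ∧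
      ClearOk I α {a, v} (R.filter fun m => !decide (m.1 = b)) ∧
      ClearOk I α {b, v} (R.filter fun m => !decide (m.1 = a)) := by
  wlog hb : I b = false generalizing a b
  · obtain ⟨R, h1, h2, h3, h4⟩ := this hab.symm hbv hav ab.symm bv av (by tauto)
      (by rwa [Set.pair_comm])
      (by cases h : I a <;> simp_all)
    exact ⟨R, fun m hm => by have := h1 m hm; tauto, h2, h4, h3⟩
  have he : (![a, b, v]).Injective := by
    simp [Function.Injective, Fin.forall_fin_succ, hab, hav, hbv, hab.symm, hav.symm, hbv.symm]
  have hs : (α ∘ ![a, b, v]).Injective := by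
    simp [Function.Injective, Fin.forall_fin_succ, ab, av, bv, ab.symm, av.symm, bv.symm]
  obtain ⟨hL1, hL2, hL3, hL4⟩ := hL
  obtain ⟨R, h1, h2, h3, h4, h5, h6, h7⟩ : ∃ R, (∀ m ∈ R, m.1 ∈ Set.range ![a, b, v]) ∧
      CliqueLegal (Set.range ![a, b, v]) α R ∧
      (R.filter fun m => !decide (m.1 = v)) = L ∧
      clearTrace (I v) (α v) (trace v R) = true ∧
      (I a = true → bad α a v (R.filter fun m => !decide (m.1 = b)) = false) ∧
      (I v = true → bad α v a (R.filter fun m => !decide (m.1 = b)) = false) ∧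
      (I v = true → bad α v b (R.filter fun m => !decide (m.1 = a)) = false) := by
    rcases hI with ⟨ha, hb', hv⟩ | ⟨ha, hb', hv⟩ | ⟨ha, hb', hv⟩
    · exact exists_triangle_extension_aux tri0 he hs
        (by simp [Fin.forall_fin_succ, ha, hb, hv]) hL1 hL2 (hL3 a (by simp))
        (hL3 b (by simp)) (fun _ => hL4 a b rfl ha hb)
    · rw [hb] at hb'; cases hb'
    · exact exists_triangle_extension_aux tri2 he hs
        (by simp [Fin.forall_fin_succ, ha, hb, hv]) hL1 hL2 (hL3 a (by simp))
        (hL3 b (by simp)) 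
        (fun h => by cases ha.symm.trans h)
  have hmem : ∀ m ∈ R, m.1 = a ∨ m.1 = b ∨ m.1 = v := by
    intro m hm
    obtain ⟨x, hx⟩ := h1 m hm
    rw [← hx]
    fin_cases x <;> simp
  have htr {x y : V} (hxy : x ≠ y) : trace x (R.filter fun m => !decide (m.1 = y)) = trace x R := by
    rw [trace, List.filter_filter, trace]
    congr 2
    ext m
    by_cases h : m.1 = x
    · simp [h, hxy]
    · simp [h]
  have hpair {x y x' y' : V} (h : ({x, y} : Set V) = {x', y'}) :
      (x' = x ∧ y' = y) ∨ (x' = y ∧ y' = x) :=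
    (Set.pair_eq_pair_iff.1 h).imp (fun h => ⟨h.1.symm, h.2.symm⟩)
      fun h => ⟨h.2.symm, h.1.symm⟩
  refine ⟨R, hmem, h3, ⟨?_, ?_, ?_, ?_⟩, ⟨?_, ?_, ?_, ?_⟩⟩
  · intro m hm
    rw [List.mem_filter] at hm
    have h' : m.1 ≠ b := by simpa using hm.2
    rcases hmem m hm.1 with h | h | h
    exacts [Or.inl h, absurd h h', Or.inr h]
  · refine h2.filter ?_ ?_ fun _ _ => rfl
    · rintro x (rfl | rfl)
      exacts [⟨0, rfl⟩, ⟨2, rfl⟩]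
    · intro m hm
      rcases Set.mem_insert_iff.1 hm with h | h
      · simp [h, hab]
      · simp [Set.mem_singleton_iff.1 h, hbv.symm]
  · rintro x (rfl | rfl)
    · rw [htr hab, ← htr hav, h3]; exact hL3 _ (by simp)
    · rw [htr hbv.symm]; exact h4
  · intro u w h hu hw
    rcases hpair h with ⟨rfl, rfl⟩ | ⟨rfl, rfl⟩
    · exact h5 hu
    · exact h6 hu
  · intro m hm
    rw [List.mem_filter] at hm
    have h' : m.1 ≠ a := by simpa using hm.2
    rcases hmem m hm.1 with h | h | h
    exacts [absurd h h', Or.inl h, Or.inr h]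
  · refine h2.filter ?_ ?_ fun _ _ => rfl
    · rintro x (rfl | rfl)
      exacts [⟨1, rfl⟩, ⟨2, rfl⟩]
    · intro m hm
      rcases Set.mem_insert_iff.1 hm with h | h
      · simp [h, hab.symm]
      · simp [Set.mem_singleton_iff.1 h, hav.symm]
  · rintro x (rfl | rfl)
    · rw [htr hab.symm, ← htr hbv, h3]; exact hL3 _ (by simp)
    · rw [htr hav.symm]; exact h4
  · intro u w h hu hw
    rcases hpair h with ⟨rfl, rfl⟩ | ⟨rfl, rfl⟩
    · rw [hb] at hu; cases hu
    · exact h7 hu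

end Triangle

section Gluing

variable {V : Type}

open Classical in
/-- The moves of vertices in `C`. -/
noncomputable def res (C : Set V) (L : List (Move V)) : List (Move V) :=
  L.filter fun m => m.1 ∈ C

@[simp]
theorem mem_res {C : Set V} {L : List (Move V)} {m : Move V} :
    m ∈ res C L ↔ m ∈ L ∧ m.1 ∈ C := by
  simp [res]

theorem res_congr {C D : Set V} {L : List (Move V)} (h : ∀ m ∈ L, m.1 ∈ C ↔ m.1 ∈ D) :
    res C L = res D L :=
  List.filter_congr fun m hm => by simp [h m hm]

theorem res_eq_self {C : Set V} {L : List (Move V)} (h : ∀ m ∈ L, m.1 ∈ C) : res C L = L :=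
  List.filter_eq_self.2 fun m hm => by simp [h m hm]

theorem res_res (C D : Set V) (L : List (Move V)) : res C (res D L) = res (C ∩ D) L := by
  rw [res, res, List.filter_filter]
  refine List.filter_congr fun m _ => ?_
  by_cases h : m.1 ∈ C <;> by_cases h' : m.1 ∈ D <;> simp [h, h']

theorem CliqueLegal.res [DecidableEq V] {C : Set V} {s : V → Fin 5} {L : List (Move V)}
    (h : CliqueLegal C s L) {D : Set V} (hDC : D ⊆ C) : CliqueLegal D s (res D L) :=
  h.filter hDC (by simp) fun _ _ => rfl

theorem res_singleton [DecidableEq V] (v : V) (L : List (Move V)) :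
    res {v} L = movesOf v (trace v L) := by
  rw [movesOf_trace]
  exact List.filter_congr fun m _ => by simp

theorem filter_ne_eq_res [DecidableEq V] (v : V) (L : List (Move V)) :
    (L.filter fun m => !decide (m.1 = v)) = res {v}ᶜ L :=
  List.filter_congr fun m _ => by by_cases h : m.1 = v <;> simp [h]

theorem trace_res [DecidableEq V] {v : V} {C : Set V} (hv : v ∈ C) (L : List (Move V)) :
    trace v (res C L) = trace v L := by
  rw [trace, res, List.filter_filter, trace]
  congr 2
  ext m
  by_cases h : m.1 = v <;> simp [h, hv]

/-- Two lists of moves agreeing on `P` can be merged. -/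
theorem exists_merge {v : V} {P : Set V} {L R : List (Move V)}
    (hL : ∀ m ∈ L, m.1 ≠ v) (hR : ∀ m ∈ R, m.1 = v ∨ m.1 ∈ P)
    (h : res {v}ᶜ R = res P L) : ∃ M, res {v}ᶜ M = L ∧ res (insert v P) M = R := by
  induction L generalizing R with
  | nil =>
    refine ⟨R, ?_, res_eq_self hR⟩
    rw [h]; rfl
  | cons m L ih =>
    have hL' : ∀ m ∈ L, m.1 ≠ v := fun m' hm' => hL m' (by simp [hm'])
    have hm : m.1 ≠ v := hL m (by simp)
    by_cases hmP : m.1 ∈ P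
    · have h' : res {v}ᶜ R = m :: res P L := by rw [h]; simp [res, hmP]
      obtain ⟨R₁, R₂, rfl, h₁, h₂, h₃⟩ := List.filter_eq_cons_iff.1 h'
      obtain ⟨M, hM₁, hM₂⟩ := ih hL' (fun m' hm' => hR m' (by simp [hm'])) h₃
      have h₁' : ∀ m ∈ R₁, m.1 = v := by simpa using h₁
      refine ⟨R₁ ++ m :: M, ?_, ?_⟩
      · have : res {v}ᶜ R₁ = [] := by simpa [res] using h₁'
        rw [res, List.filter_append]
        change res {v}ᶜ R₁ ++ List.filter _ (m :: M) = _
        rw [this, List.nil_append, List.filter_cons_of_pos (by simpa using hm)]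
        exact congrArg _ hM₁
      · have : res (insert v P) R₁ = R₁ := res_eq_self fun m hm => Or.inl (h₁' m hm)
        rw [res, List.filter_append]
        change res (insert v P) R₁ ++ List.filter _ (m :: M) = _
        rw [this, List.filter_cons_of_pos (by simp [hmP])]
        congr 2
    · obtain ⟨M, hM₁, hM₂⟩ := ih hL' hR (by rw [h]; simp [res, hmP])
      refine ⟨m :: M, ?_, ?_⟩
      · rw [res, List.filter_cons_of_pos (by simpa using hm)]
        exact congrArg _ hM₁
      · rw [res, List.filter_cons_of_neg (by simp [hmP, hm])]
        exact hM₂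

variable [DecidableEq V] {f : V → ℕ} {P : V → Set V} {cells : Set (Set V)}
  {Ok : Set V → List (Move V) → Prop} {VT : V → List (Fin 5) → Prop}

theorem exists_glued_lt (hf : f.Injective) (hP : ∀ u v, u ∈ P v → f u < f v)
    (hcl : ∀ C ∈ cells, ∀ u ∈ C, ∀ v ∈ C, f u < f v → u ∈ P v)
    (hsub : ∀ C ∈ cells, ∀ D ∈ cells, C ≠ D → (C ∩ D).Subsingleton)
    (hmem : ∀ C R, Ok C R → ∀ m ∈ R, m.1 ∈ C)
    (hVT : ∀ C R, Ok C R → ∀ v ∈ C, VT v (trace v R))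
    (hroot : ∀ C ∈ cells, ∀ v ∈ C, ∀ τ, VT v τ → ∃ R, Ok C R ∧ trace v R = τ)
    (hinit : ∀ v, ∃ τ, VT v τ)
    (hstep : ∀ v, (P v).Nonempty → (∃ C ∈ cells, v ∈ C ∧ P v ⊆ C) ∨
      ∃ a b, a ≠ b ∧ P v = {a, b} ∧ {a, b} ∈ cells ∧ {a, v} ∈ cells ∧ {b, v} ∈ cells ∧
        ∀ R₀, Ok {a, b} R₀ → ∃ R : List (Move V), (∀ m ∈ R, m.1 = a ∨ m.1 = b ∨ m.1 = v) ∧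
          res {v}ᶜ R = R₀ ∧ Ok {a, v} (res {b}ᶜ R) ∧ Ok {b, v} (res {a}ᶜ R)) (n : ℕ) :
    ∃ L : List (Move V), (∀ m ∈ L, f m.1 < n) ∧
      ∀ C ∈ cells, (∃ u ∈ C, f u < n) → ∃ R, Ok C R ∧ res {u | f u < n} R = res C L := by
  induction n with
  | zero => exact ⟨[], by simp, by simp⟩
  | succ n ih =>
    obtain ⟨L, hL, hLC⟩ := ih
    by_cases hn : ∃ v, f v = n
    swap
    · have hlt (u) : f u < n + 1 ↔ f u < n := by
        have : f u ≠ n := fun h => hn ⟨u, h⟩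
        omega
      simp only [hlt]
      exact ⟨L, hL, hLC⟩
    obtain ⟨v, rfl⟩ := hn
    have hlt (u) : f u < f v + 1 ↔ f u < f v ∨ u = v := by
      rw [Nat.lt_succ_iff_lt_or_eq, hf.eq_iff]
    have hvP : v ∉ P v := fun h => lt_irrefl _ (hP _ _ h)
    have key : ∃ R : List (Move V), (∀ m ∈ R, m.1 = v ∨ m.1 ∈ P v) ∧
        res {v}ᶜ R = res (P v) L ∧ VT v (trace v R) ∧
        ∀ C ∈ cells, v ∈ C → (∃ u ∈ C, f u < f v) →
          ∃ R', Ok C R' ∧ res {u | f u < f v + 1} R' = res C R := by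
      rcases (P v).eq_empty_or_nonempty with hPv | hPv
      · obtain ⟨τ, hτ⟩ := hinit v
        refine ⟨movesOf v τ, by simp [movesOf], ?_, by rwa [trace_movesOf], ?_⟩
        · simp [hPv, res, movesOf]
        · rintro C hC hv ⟨u, hu, huv⟩
          have := hcl C hC u hu v hv huv
          simp [hPv] at this
      rcases hstep v hPv with ⟨C, hC, hv, hPC⟩ | ⟨a, b, hab', hab, h₁, h₂, h₃, hext⟩
      · obtain ⟨u, hu⟩ := hPv
        obtain ⟨R, hR, hRL⟩ := hLC C hC ⟨u, hPC hu, hP _ _ hu⟩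
        have hCP (u) (hu : u ∈ C) : f u < f v ↔ u ∈ P v :=
          ⟨hcl C hC u hu v hv, hP u v⟩
        refine ⟨res {u | f u < f v + 1} R, ?_, ?_, ?_, ?_⟩
        · intro m hm
          rw [mem_res, Set.mem_ofPred_eq, hlt] at hm
          rcases hm.2 with h | h
          · exact Or.inr ((hCP _ (hmem _ _ hR m hm.1)).1 h)
          · exact Or.inl h
        · have e₁ : res {v}ᶜ (res {u | f u < f v + 1} R) = res {u | f u < f v} R := by
            rw [res_res]
            refine res_congr fun m _ => ?_
            simp only [Set.mem_inter_iff, Set.mem_compl_iff, Set.mem_singleton_iff,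
              Set.mem_ofPred_eq, hlt]
            refine ⟨fun h => h.2.resolve_right h.1, fun h => ⟨?_, Or.inl h⟩⟩
            rintro rfl
            exact lt_irrefl _ h
          rw [e₁, hRL]
          exact res_congr fun m hm =>
            ⟨fun h => (hCP _ h).1 (hL m hm), fun h => hPC h⟩
        · rw [trace_res (by simp)]
          exact hVT _ _ hR v hv
        · rintro D hD hvD ⟨w, hw, hwv⟩
          have hwP := hcl D hD w hw v hvD hwv
          obtain rfl : D = C := by
            by_contra hne
            have := hsub D hD C hC hne ⟨hw, hPC hwP⟩ ⟨hvD, hv⟩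
            rw [this] at hwv
            exact lt_irrefl _ hwv
          refine ⟨R, hR, (res_eq_self fun m hm => ?_).symm⟩
          exact hmem _ _ hR m (mem_res.1 hm).1
      · have ha : a ∈ P v := by simp [hab]
        have hb : b ∈ P v := by simp [hab]
        obtain ⟨R₀, hR₀, hRL⟩ := hLC _ h₁ ⟨a, by simp, hP _ _ ha⟩
        obtain ⟨R, hR, hRR₀, hav, hbv⟩ := hext R₀ hR₀
        have hne (c) (hc : c ∈ P v) : v ≠ c := by rintro rfl; exact hvP hc
        have hcell (c d : V) (hd : d ∈ P v) (hR' : ∀ m ∈ R, m.1 = c ∨ m.1 = d ∨ m.1 = v)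
            (h : {c, v} ∈ cells) (hc : c ∈ P v) (hcd : c ≠ d) (hOk : Ok {c, v} (res {d}ᶜ R))
            (D) (hD : D ∈ cells) (hvD : v ∈ D) (hcD : c ∈ D) :
            ∃ R', Ok D R' ∧ res {u | f u < f v + 1} R' = res D R := by
          obtain rfl : D = {c, v} := by
            by_contra hne'
            exact hne c hc (hsub D hD _ h hne' ⟨hvD, by simp⟩ ⟨hcD, by simp⟩)
          refine ⟨_, hOk, ?_⟩
          rw [res_res]
          refine res_congr fun m hm => ?_
          rcases hR' m hm with h | h | h
          · have := hP _ _ hc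
            simp [h, hcd]; omega
          · simp [h, hcd.symm, (hne d hd).symm]
          · simp [h, hne d hd]
        refine ⟨R, ?_, ?_, ?_, ?_⟩
        · intro m hm
          have := hR m hm
          rw [hab]
          simp only [Set.mem_insert_iff, Set.mem_singleton_iff]
          tauto
        · rw [hRR₀, hab, ← hRL]
          refine (res_eq_self fun m hm => ?_).symm
          have := hmem _ _ hR₀ m hm
          rw [← hab] at this
          exact hP _ _ this
        · have := hVT _ _ hav v (by simp)
          rwa [trace_res (by simpa using hne b hb)] at this
        · rintro D hD hvD ⟨w, hw, hwv⟩
          have hwP := hcl D hD w hw v hvD hwv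
          rw [hab] at hwP
          rcases hwP with rfl | rfl
          · exact hcell w b hb hR h₂ ha hab' hav D hD hvD hw
          · exact hcell w a ha (fun m hm => by have := hR m hm; tauto) h₃ hb hab'.symm hbv
              D hD hvD hw
    obtain ⟨R, hRP, hRL, hRv, hRC⟩ := key
    have hLv : ∀ m ∈ L, m.1 ≠ v := by
      rintro m hm rfl
      exact lt_irrefl _ (hL m hm)
    obtain ⟨M, hML, hMR⟩ := exists_merge hLv hRP hRL
    have hM : ∀ m ∈ M, f m.1 < f v + 1 := by
      intro m hm
      rw [hlt]
      by_cases h : m.1 = v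
      · exact Or.inr h
      · left
        refine hL m ?_
        rw [← hML]
        simp [hm, h]
    refine ⟨M, hM, fun C hC hCn => ?_⟩
    by_cases hv : v ∈ C
    · by_cases hu : ∃ u ∈ C, f u < f v
      · obtain ⟨R', hR', h⟩ := hRC C hC hv hu
        refine ⟨R', hR', ?_⟩
        rw [h, ← hMR, res_res]
        refine res_congr fun m hm => ?_
        have := (hlt _).1 (hM m hm)
        simp only [Set.mem_inter_iff, Set.mem_insert_iff, and_iff_left_iff_imp]
        intro hmC
        exact this.symm.imp id (hcl C hC _ hmC v hv)
      · push Not at hu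
        obtain ⟨R', hR', h⟩ := hroot C hC v hv _ hRv
        refine ⟨R', hR', ?_⟩
        have e₁ : res {u | f u < f v + 1} R' = res {v} R' := by
          refine res_congr fun m hm => ?_
          have := hu m.1 (hmem _ _ hR' m hm)
          simp [hlt, not_lt.2 this]
        have e₂ : res C M = res {v} M := by
          refine res_congr fun m hm => ?_
          have := (hlt _).1 (hM m hm)
          refine ⟨fun h => ?_, fun h => by rw [Set.mem_singleton_iff.1 h]; exact hv⟩
          exact this.resolve_left (not_lt.2 (hu _ h))
        rw [e₁, e₂, res_singleton, res_singleton, h, ← hMR, trace_res (by simp)]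
    · have hCn' : ∃ u ∈ C, f u < f v := by
        obtain ⟨u, hu, h⟩ := hCn
        refine ⟨u, hu, ((hlt u).1 h).resolve_right ?_⟩
        rintro rfl
        exact hv hu
      obtain ⟨R', hR', h⟩ := hLC C hC hCn'
      refine ⟨R', hR', ?_⟩
      rw [← hML, res_res] at h
      have e₁ : res {u | f u < f v + 1} R' = res {u | f u < f v} R' := by
        refine res_congr fun m hm => ?_
        have : m.1 ≠ v := by
          intro h
          exact hv (h ▸ hmem _ _ hR' m hm)
        simp [hlt, this]
      rw [e₁, h]
      refine res_congr fun m _ => ?_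
      simp only [Set.mem_inter_iff, Set.mem_compl_iff, Set.mem_singleton_iff,
        and_iff_left_iff_imp]
      rintro hmC rfl
      exact hv hmC

theorem exists_glued [Finite V] (hf : f.Injective) (hP : ∀ u v, u ∈ P v → f u < f v)
    (hcl : ∀ C ∈ cells, ∀ u ∈ C, ∀ v ∈ C, f u < f v → u ∈ P v)
    (hsub : ∀ C ∈ cells, ∀ D ∈ cells, C ≠ D → (C ∩ D).Subsingleton)
    (hne : ∀ C ∈ cells, C.Nonempty)
    (hmem : ∀ C R, Ok C R → ∀ m ∈ R, m.1 ∈ C)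
    (hVT : ∀ C R, Ok C R → ∀ v ∈ C, VT v (trace v R))
    (hroot : ∀ C ∈ cells, ∀ v ∈ C, ∀ τ, VT v τ → ∃ R, Ok C R ∧ trace v R = τ)
    (hinit : ∀ v, ∃ τ, VT v τ)
    (hstep : ∀ v, (P v).Nonempty → (∃ C ∈ cells, v ∈ C ∧ P v ⊆ C) ∨
      ∃ a b, a ≠ b ∧ P v = {a, b} ∧ {a, b} ∈ cells ∧ {a, v} ∈ cells ∧ {b, v} ∈ cells ∧
        ∀ R₀, Ok {a, b} R₀ → ∃ R : List (Move V), (∀ m ∈ R, m.1 = a ∨ m.1 = b ∨ m.1 = v) ∧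
          res {v}ᶜ R = R₀ ∧ Ok {a, v} (res {b}ᶜ R) ∧ Ok {b, v} (res {a}ᶜ R)) :
    ∃ L : List (Move V), ∀ C ∈ cells, Ok C (res C L) := by
  obtain ⟨N, hN⟩ := (Set.finite_range f).bddAbove
  obtain ⟨L, -, hL⟩ := exists_glued_lt hf hP hcl hsub hmem hVT hroot hinit hstep (N + 1)
  have hlt (u) : f u < N + 1 := Nat.lt_succ_of_le (hN ⟨u, rfl⟩)
  refine ⟨L, fun C hC => ?_⟩
  obtain ⟨u, hu⟩ := hne C hC
  obtain ⟨R, hR, h⟩ := hL C hC ⟨u, hu, hlt u⟩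
  rwa [← h, res_eq_self fun m _ => hlt m.1]

end Gluing

section Sequences

variable {V : Type} [DecidableEq V]

/-- Every move of the list, performed from `s`, is a recoloring step for proper colorings. -/
def Legal (H : SimpleGraph V) : (V → Fin 5) → List (Move V) → Prop
  | _, [] => True
  | s, m :: L => s m.1 ≠ m.2 ∧ (∀ u, H.Adj m.1 u → s u ≠ m.2) ∧
      Legal H (Function.update s m.1 m.2) L

variable {H : SimpleGraph V}

theorem run_append (s : V → Fin 5) (L L' : List (Move V)) :
    run s (L ++ L') = run (run s L) L' := by
  induction L generalizing s with
  | nil => rfl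
  | cons m L ih => exact ih _

theorem legal_append {s : V → Fin 5} {L L' : List (Move V)} :
    Legal H s (L ++ L') ↔ Legal H s L ∧ Legal H (run s L) L' := by
  induction L generalizing s with
  | nil => simp [Legal, run]
  | cons m L ih => simp [Legal, run, ih, and_assoc]

theorem run_apply (s : V → Fin 5) (L : List (Move V)) (v : V) :
    run s L v = (trace v L).getLastD (s v) := by
  induction L generalizing s with
  | nil => rfl
  | cons m L ih =>
    rw [run, ih, trace_cons]
    split
    · next h => subst h; rw [Function.update_self, List.getLastD_cons]
    · next h => rw [Function.update_of_ne (Ne.symm h)]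

theorem trace_append (v : V) (L L' : List (Move V)) :
    trace v (L ++ L') = trace v L ++ trace v L' := by
  simp [trace]

theorem isProperColoring_update {s : V → Fin 5} (hs : IsProperColoring H s) {m : Move V}
    (h : ∀ u, H.Adj m.1 u → s u ≠ m.2) : IsProperColoring H (Function.update s m.1 m.2) := by
  intro u v huv
  have hne := H.ne_of_adj huv
  by_cases hu : u = m.1
  · subst hu
    rw [Function.update_self, Function.update_of_ne hne.symm]
    exact (h v huv).symm
  · by_cases hv : v = m.1
    · subst hv
      rw [Function.update_self, Function.update_of_ne hu]
      exact h u huv.symm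
    · rw [Function.update_of_ne hu, Function.update_of_ne hv]
      exact hs huv

theorem Legal.isProperColoring {s : V → Fin 5} {L : List (Move V)} (h : Legal H s L)
    (hs : IsProperColoring H s) : IsProperColoring H (run s L) := by
  induction L generalizing s with
  | nil => exact hs
  | cons m L ih => exact ih h.2.2 (isProperColoring_update hs h.2.1)

/-- `β` can be reached from `α` by recoloring each vertex at most `k` times. -/
def Reach (H : SimpleGraph V) (k : ℕ) (α β : V → Fin 5) : Prop :=
  ∃ L, Legal H α L ∧ run α L = β ∧ ∀ v, (trace v L).length ≤ k

theorem Reach.trans {k l : ℕ} {α β γ : V → Fin 5} (h₁ : Reach H k α β) (h₂ : Reach H l β γ) :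
    Reach H (k + l) α γ := by
  obtain ⟨L₁, h₁, rfl, h₁'⟩ := h₁
  obtain ⟨L₂, h₂, rfl, h₂'⟩ := h₂
  refine ⟨L₁ ++ L₂, legal_append.2 ⟨h₁, h₂⟩, run_append _ _ _, fun v => ?_⟩
  rw [trace_append, List.length_append]
  exact Nat.add_le_add (h₁' v) (h₂' v)

theorem Legal.exists_reverse {s : V → Fin 5} {L : List (Move V)} (h : Legal H s L)
    (hs : IsProperColoring H s) : ∃ L', Legal H (run s L) L' ∧ run (run s L) L' = s ∧
      ∀ v, (trace v L').length = (trace v L).length := by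
  induction L generalizing s with
  | nil => exact ⟨[], trivial, rfl, fun _ => rfl⟩
  | cons m L ih =>
    obtain ⟨L', h₁, h₂, h₃⟩ := ih h.2.2 (isProperColoring_update hs h.2.1)
    refine ⟨L' ++ [(m.1, s m.1)], legal_append.2 ⟨h₁, ?_⟩, ?_, fun v => ?_⟩
    · change Legal H (run (run (Function.update s m.1 m.2) L) L') _
      rw [h₂]
      refine ⟨by simpa using h.1.symm, fun u hu => ?_, trivial⟩
      rw [Function.update_of_ne (H.ne_of_adj hu).symm]
      exact (hs hu).symm
    · rw [run_append]
      change run (run (run (Function.update s m.1 m.2) L) L') _ = _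
      rw [h₂]
      simp [run]
    · rw [trace_append, List.length_append, h₃, trace_cons, trace_cons]
      split <;> simp [trace]

theorem Reach.symm {k : ℕ} {α β : V → Fin 5} (h : Reach H k α β)
    (hα : IsProperColoring H α) : Reach H k β α := by
  obtain ⟨L, h₁, rfl, h₂⟩ := h
  obtain ⟨L', h₁', h₂', h₃⟩ := h₁.exists_reverse hα
  exact ⟨L', h₁', h₂', fun v => h₃ v ▸ h₂ v⟩

theorem Reach.isProperColoring {k : ℕ} {α β : V → Fin 5} (h : Reach H k α β)
    (hα : IsProperColoring H α) : IsProperColoring H β := by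
  obtain ⟨L, h₁, rfl, -⟩ := h
  exact h₁.isProperColoring hα

theorem card_filter_getElem {κ : Type} (L : List κ) (p : κ → Prop) [DecidablePred p] :
    (Finset.univ.filter fun i : Fin L.length => p L[i]).card =
      (L.filter fun a => decide (p a)).length := by
  induction L with
  | nil => rfl
  | cons a L ih =>
    rw [List.filter_cons]
    have := Fin.card_filter_univ_succ (n := L.length) fun i => p (a :: L)[i]
    refine this.trans ?_
    by_cases h : p a
    · simp [h]
      exact ih
    · simp [h]
      exact ih

/-- A legal list of moves yields a transformation sequence. -/
theorem Reach.exists_isTransformSeq {k : ℕ} {α β : V → Fin 5} (h : Reach H k α β)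
    (hα : IsProperColoring H α) : ∃ (m : ℕ) (c : Fin (m + 1) → V → Fin 5),
      IsTransformSeq H c α β ∧ ∀ v, RecolorCount c v ≤ k := by
  obtain ⟨L, hL, rfl, hk⟩ := h
  have hstep (i : Fin L.length) :
      run α (L.take (i + 1)) = Function.update (run α (L.take i)) L[i].1 L[i].2 := by
    rw [List.take_succ_eq_append_getElem i.2, run_append]
    rfl
  have hlegal (n : ℕ) : Legal H α (L.take n) := by
    rw [← List.take_append_drop n L] at hL
    exact (legal_append.1 hL).1
  have hne (i : Fin L.length) : run α (L.take i) L[i].1 ≠ L[i].2 := by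
    have := hlegal (i + 1)
    rw [List.take_succ_eq_append_getElem i.2, legal_append] at this
    exact this.2.1
  have hiff (i : Fin L.length) (v : V) :
      run α (L.take i) v ≠ run α (L.take (i + 1)) v ↔ L[i].1 = v := by
    rw [hstep]
    by_cases h : v = L[i].1
    · subst h
      simpa using hne i
    · rw [Function.update_of_ne h]
      exact ⟨fun h' => absurd rfl h', fun h' => absurd h'.symm h⟩
  refine ⟨L.length, fun i => run α (L.take i), ⟨by simp [run], by simp, fun i => ?_, fun i => ?_⟩,
    fun v => ?_⟩
  · exact (hlegal i).isProperColoring hα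
  · refine ⟨L[i].1, (hiff i _).2 rfl, fun v hv => ((hiff i v).1 hv).symm⟩
  · refine le_trans (le_of_eq ?_) (hk v)
    rw [RecolorCount, trace, List.length_map, ← card_filter_getElem]
    congr 1
    ext i
    simp only [Finset.mem_filter, Finset.mem_univ, true_and]
    exact hiff i v

theorem cliqueLegal_res_tail {C : Set V} {s : V → Fin 5} {m : Move V} {L : List (Move V)}
    (h : CliqueLegal C s (res C (m :: L))) :
    CliqueLegal C (Function.update s m.1 m.2) (res C L) := by
  by_cases hm : m.1 ∈ C
  · rw [res, List.filter_cons_of_pos (by simpa using hm)] at h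
    exact h.2
  · rw [res, List.filter_cons_of_neg (by simpa using hm)] at h
    have := h.filter subset_rfl (p := fun _ => true) (fun _ _ => rfl)
      (s' := Function.update s m.1 m.2) fun v hv => by
        rw [Function.update_of_ne]
        rintro rfl
        exact hm hv
    rwa [List.filter_true] at this

theorem cliqueLegal_res_head {C : Set V} {s : V → Fin 5} {m : Move V} {L : List (Move V)}
    (h : CliqueLegal C s (res C (m :: L))) (hm : m.1 ∈ C) : ∀ u ∈ C, s u ≠ m.2 := by
  rw [res, List.filter_cons_of_pos (by simpa using hm)] at h
  exact h.1

theorem legal_of_cliqueLegal {s : V → Fin 5} {L : List (Move V)}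
    (h₁ : ∀ v, CliqueLegal {v} s (res {v} L))
    (h₂ : ∀ u v, H.Adj u v → CliqueLegal {u, v} s (res {u, v} L)) : Legal H s L := by
  induction L generalizing s with
  | nil => trivial
  | cons m L ih =>
    exact ⟨cliqueLegal_res_head (h₁ m.1) rfl m.1 rfl,
      fun u hu => cliqueLegal_res_head (h₂ _ _ hu) (by simp) u (by simp),
      ih (fun v => cliqueLegal_res_tail (h₁ v)) fun u v huv => cliqueLegal_res_tail (h₂ u v huv)⟩

theorem CliqueLegal.insert_of_forall_ne {u v : V} {s : V → Fin 5} {R : List (Move V)}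
    (h : CliqueLegal {v} s R) (hR : ∀ m ∈ R, m.1 ≠ u ∧ m.2 ≠ s u) : CliqueLegal {u, v} s R := by
  induction R generalizing s with
  | nil => trivial
  | cons m R ih =>
    have hm := hR m (by simp)
    refine ⟨?_, ih h.2 fun m' hm' => ?_⟩
    · rintro w (rfl | hw)
      · exact hm.2.symm
      · exact h.1 w hw
    · rw [Function.update_of_ne hm.1.symm]
      exact hR m' (by simp [hm'])

/-- Recolor an independent set with a color which is unused outside of it. -/
theorem reach_zero [Finite V] {s : V → Fin 5} {I : V → Bool}
    (hI : ∀ u v, H.Adj u v → ¬(I u = true ∧ I v = true)) (hs : ∀ v, I v = false → s v ≠ 0) :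
    Reach H 1 s fun v => if I v then 0 else s v := by
  classical
  have : Fintype V := Fintype.ofFinite V
  have key : ∀ l : List V, l.Nodup → (∀ v ∈ l, I v = true) → ∀ s : V → Fin 5,
      (∀ v, I v = false → s v ≠ 0) → (∀ v ∈ l, s v ≠ 0) →
      Legal H s (l.map fun v => (v, 0)) ∧
        (∀ v, run s (l.map fun v => (v, 0)) v = if v ∈ l then 0 else s v) ∧
        ∀ v, (trace v (l.map fun v => ((v, 0) : Move V))).length ≤ l.count v := by
    intro l
    induction l with
    | nil => intro _ _ s _ _; exact ⟨trivial, by simp [run], by simp [trace]⟩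
    | cons a l ih =>
      intro hl hlI s hs hls
      rw [List.nodup_cons] at hl
      have hne {v} (hv : v ∈ l) : v ≠ a := by rintro rfl; exact hl.1 hv
      have ha := hlI a (by simp)
      obtain ⟨h₁, h₂, h₃⟩ := ih hl.2 (fun v hv => hlI v (by simp [hv]))
        (Function.update s a 0) (fun v hv => by
          have : v ≠ a := by rintro rfl; rw [ha] at hv; cases hv
          rw [Function.update_of_ne this]; exact hs v hv) (fun v hv => by
          rw [Function.update_of_ne (hne hv)]; exact hls v (by simp [hv]))
      refine ⟨⟨hls a (by simp), fun u hu => hs u ?_, h₁⟩, fun v => ?_, fun v => ?_⟩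
      · have := hI a u hu
        simpa [ha] using this
      · refine (h₂ v).trans ?_
        by_cases hv : v = a
        · subst hv; simp
        · simp [hv]
      · have := h₃ v
        rw [List.map_cons, trace_cons, List.count_cons]
        by_cases h : a = v <;> simp [h] <;> simpa using this
  obtain ⟨h₁, h₂, h₃⟩ := key (Finset.univ.filter fun v => I v = true ∧ s v ≠ 0).toList
    (Finset.nodup_toList _) (by simp +contextual) s hs (by simp)
  refine ⟨_, h₁, ?_,
    fun v => (h₃ v).trans (List.nodup_iff_count_le_one.1 (Finset.nodup_toList _) v)⟩
  ext1 v
  rw [h₂]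
  by_cases h : I v = true <;> by_cases h' : s v = 0 <;> simp [h, h']

end Sequences

section Elimination

variable {V : Type} {H : SimpleGraph V}

/-- The edges of `H` inside of `T`. -/
def inside (H : SimpleGraph V) (T : Set V) : SimpleGraph V where
  Adj u v := H.Adj u v ∧ u ∈ T ∧ v ∈ T
  symm := ⟨fun _ _ h => ⟨h.1.symm, h.2.2, h.2.1⟩⟩
  loopless := ⟨fun _ h => H.loopless.irrefl _ h.1⟩

theorem inside_le (T : Set V) : inside H T ≤ H := fun _ _ h => h.1

theorem inside_mono {S T : Set V} (h : S ⊆ T) : inside H S ≤ inside H T :=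
  fun _ _ h' => ⟨h'.1, h h'.2.1, h h'.2.2⟩

theorem mem_of_mem_support_inside {T : Set V} {x y w : V} (p : (inside H T).Walk x y) (hx : x ∈ T)
    (hw : w ∈ p.support) : w ∈ T := by
  induction p with
  | nil => simpa [List.mem_singleton.1 hw] using hx
  | cons h p ih =>
    rcases List.mem_cons.1 hw with rfl | hw
    · exact hx
    · exact ih h.2.2 hw

/-- A shortest path has no chords. -/
theorem mem_edges_of_length_eq_dist {G : SimpleGraph V} {x y u w : V} {p : G.Walk x y}
    (hp : p.length = G.dist x y) (hu : u ∈ p.support) (hw : w ∈ p.support) (h : G.Adj u w) :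
    s(u, w) ∈ p.edges := by
  obtain ⟨i, rfl, hi⟩ := SimpleGraph.Walk.mem_support_iff_exists_getVert.1 hu
  obtain ⟨j, rfl, hj⟩ := SimpleGraph.Walk.mem_support_iff_exists_getVert.1 hw
  have key {i j : ℕ} (hij : i < j) (hj : j ≤ p.length) (h : G.Adj (p.getVert i) (p.getVert j)) :
      s(p.getVert i, p.getVert j) ∈ p.edges := by
    have := SimpleGraph.dist_le ((p.take i).append (.cons h (p.drop j)))
    rw [← hp, SimpleGraph.Walk.length_append, SimpleGraph.Walk.length_cons,
      SimpleGraph.Walk.take_length, SimpleGraph.Walk.drop_length] at this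
    obtain rfl : j = i + 1 := by omega
    exact p.mk_mem_edges_iff_exists.2 ⟨i, hij.trans_le hj, rfl⟩
  rcases lt_trichotomy i j with hij | rfl | hij
  · exact key hij hj h
  · exact absurd h (G.loopless.irrefl _)
  · rw [Sym2.eq_swap]
    exact key hij hi h.symm

theorem adj_of_reachable (hch : IsChordal H) {a x y : V} {R : Set V}
    (hR : ∀ w ∈ R, w ≠ a ∧ ¬H.Adj a w) (hx : H.Adj a x) (hy : H.Adj a y) (hxy : x ≠ y)
    (h : (inside H (insert x (insert y R))).Reachable x y) : H.Adj x y := by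
  by_contra hadj
  obtain ⟨p, hp⟩ := h.exists_walk_length_eq_dist
  have hpath := p.isPath_of_length_eq_dist hp
  have hsupp {w : V} (hw : w ∈ p.support) := mem_of_mem_support_inside p (by simp) hw
  have ha : a ∉ p.support := fun ha => by
    rcases hsupp ha with rfl | rfl | ha
    · exact H.loopless.irrefl _ hx
    · exact H.loopless.irrefl _ hy
    · exact (hR a ha).1 rfl
  have hlen : 2 ≤ p.length := by
    by_contra hlt
    rcases p with _ | ⟨h, _ | ⟨h', p⟩⟩
    · exact hxy rfl
    · exact hadj h.1
    · simp at hlt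
  set q := p.mapLe (inside_le _) with hq
  have hqs : q.support = p.support := by simp [hq]
  have hqe : q.edges = p.edges := by simp [hq]
  have hql : q.length = p.length := by simp [hq]
  have hqp : q.IsPath := hpath.mapLe _
  have hcyc : (SimpleGraph.Walk.cons hx (q.concat hy.symm)).IsCycle := by
    rw [SimpleGraph.Walk.cons_isCycle_iff]
    refine ⟨hqp.concat (by rwa [hqs]) _, fun hmem => ?_⟩
    rw [SimpleGraph.Walk.edges_concat, List.concat_eq_append, List.mem_append, hqe] at hmem
    rcases hmem with hmem | hmem
    · exact ha (p.fst_mem_support_of_mem_edges hmem)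
    · simp [hxy] at hmem
      exact hxy (hmem.1 ▸ hmem.2)
  obtain ⟨u, w, hu, hw, huw, hnot⟩ := hch _ _ hcyc (by simp [hql]; omega)
  have hmem {z : V} (hz : z ∈ (SimpleGraph.Walk.cons hx (q.concat hy.symm)).support) :
      z = a ∨ z ∈ p.support := by
    simp [SimpleGraph.Walk.support_concat, hqs] at hz
    tauto
  have hnbr {z : V} (hz : z ∈ p.support) (haz : H.Adj a z) : z = x ∨ z = y := by
    rcases hsupp hz with h | h | h
    · exact .inl h
    · exact .inr h
    · exact absurd haz (hR z h).2
  simp only [SimpleGraph.Walk.edges_cons, SimpleGraph.Walk.edges_concat, List.concat_eq_append,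
    hqe, List.mem_cons, List.mem_append, List.not_mem_nil, or_false, not_or] at hnot
  rcases hmem hu with rfl | hu'
  · rcases hmem hw with rfl | hw'
    · exact H.loopless.irrefl _ huw
    · rcases hnbr hw' huw with rfl | rfl
      · exact hnot.1 rfl
      · exact hnot.2.2 Sym2.eq_swap
  · rcases hmem hw with rfl | hw'
    · rcases hnbr hu' huw.symm with rfl | rfl
      · exact hnot.1 Sym2.eq_swap
      · exact hnot.2.2 rfl
    · exact hnot.2.1 (mem_edges_of_length_eq_dist hp hu' hw' ⟨huw, hsupp hu', hsupp hw'⟩)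

/-- **Dirac's theorem**: in a chordal graph, every vertex which is not adjacent to all others is
not adjacent to some simplicial vertex. -/
theorem exists_simplicial (hch : IsChordal H) (W : Finset V) :
    ∀ a ∈ W, (∃ c ∈ W, c ≠ a ∧ ¬H.Adj a c) →
      ∃ v ∈ W, v ≠ a ∧ ¬H.Adj a v ∧ H.IsClique {u | u ∈ W ∧ H.Adj v u} := by
  classical
  induction W using Finset.strongInduction with
  | H W ih =>
  rintro a ha ⟨c, hc, hca, hac⟩
  let R : Set V := {w | w ∈ W ∧ w ≠ a ∧ ¬H.Adj a w}
  let C : Finset V := W.filter fun z => (inside H R).Reachable c z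
  let S : Finset V := W.filter fun s => H.Adj a s ∧ ∃ z ∈ C, H.Adj z s
  have hcR : c ∈ R := ⟨hc, hca, hac⟩
  have hCR {z : V} (hz : z ∈ C) : z ∈ R := by
    obtain ⟨p⟩ := (Finset.mem_filter.1 hz).2
    exact mem_of_mem_support_inside p hcR p.end_mem_support
  have hcC : c ∈ C := Finset.mem_filter.2 ⟨hc, .rfl⟩
  have hS : H.IsClique S := by
    intro x hx y hy hxy
    obtain ⟨-, hax, z, hz, hzx⟩ := Finset.mem_filter.1 hx
    obtain ⟨-, hay, z', hz', hzy⟩ := Finset.mem_filter.1 hy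
    refine adj_of_reachable hch (R := R) (fun w hw => hw.2) hax hay hxy ?_
    have h₁ : (inside H R).Reachable z z' :=
      (Finset.mem_filter.1 hz).2.symm.trans (Finset.mem_filter.1 hz').2
    have h₂ : (inside H (insert x (insert y R))).Reachable z z' :=
      h₁.mono (inside_mono fun w hw => by simp [hw])
    have h₃ : (inside H (insert x (insert y R))).Adj x z := ⟨hzx.symm, by simp, by simp [hCR hz]⟩
    have h₄ : (inside H (insert x (insert y R))).Adj z' y := ⟨hzy, by simp [hCR hz'], by simp⟩
    exact h₃.reachable.trans (h₂.trans h₄.reachable)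
  have hnb {z u : V} (hz : z ∈ C) (hu : u ∈ W) (hzu : H.Adj z u) : u ∈ C ∪ S := by
    rw [Finset.mem_union]
    by_cases hau : H.Adj a u
    · exact .inr (Finset.mem_filter.2 ⟨hu, hau, z, hz, hzu⟩)
    · refine .inl (Finset.mem_filter.2 ⟨hu, (Finset.mem_filter.1 hz).2.trans ?_⟩)
      refine SimpleGraph.Adj.reachable (G := inside H R) ⟨hzu, hCR hz, hu, ?_, hau⟩
      rintro rfl
      exact (hCR hz).2.2 hzu.symm
  have hsub : C ∪ S ⊆ W := Finset.union_subset (Finset.filter_subset _ _) (Finset.filter_subset _ _)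
  have hss : C ∪ S ⊂ W := by
    refine (Finset.ssubset_iff_of_subset hsub).2 ⟨a, ha, fun h => ?_⟩
    rcases Finset.mem_union.1 h with h | h
    · exact (hCR h).2.1 rfl
    · exact H.loopless.irrefl _ (Finset.mem_filter.1 h).2.1
  have hfin : (∃ v ∈ C, H.IsClique {u | u ∈ C ∪ S ∧ H.Adj v u}) →
      ∃ v ∈ W, v ≠ a ∧ ¬H.Adj a v ∧ H.IsClique {u | u ∈ W ∧ H.Adj v u} := by
    rintro ⟨v, hv, hcl⟩
    exact ⟨v, (hCR hv).1, (hCR hv).2.1, (hCR hv).2.2,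
      fun x hx y hy => hcl ⟨hnb hv hx.1 hx.2, hx.2⟩ ⟨hnb hv hy.1 hy.2, hy.2⟩⟩
  refine hfin ?_
  by_cases h₁ : ∃ s ∈ S, ∃ d ∈ C ∪ S, d ≠ s ∧ ¬H.Adj s d
  · obtain ⟨s, hs, hd⟩ := h₁
    obtain ⟨v, hv, hvs, hsv, hcl⟩ := ih _ hss s (Finset.mem_union_right _ hs) hd
    rcases Finset.mem_union.1 hv with hv | hv
    · exact ⟨v, hv, hcl⟩
    · exact absurd (hS hs hv hvs.symm) hsv
  push Not at h₁
  by_cases h₂ : ∃ x ∈ C, ∃ d ∈ C ∪ S, d ≠ x ∧ ¬H.Adj x d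
  · obtain ⟨x, hx, hd⟩ := h₂
    obtain ⟨v, hv, hvx, hxv, hcl⟩ := ih _ hss x (Finset.mem_union_left _ hx) hd
    rcases Finset.mem_union.1 hv with hv | hv
    · exact ⟨v, hv, hcl⟩
    · exact absurd (h₁ v hv x (Finset.mem_union_left _ hx) hvx.symm).symm hxv
  push Not at h₂
  refine ⟨c, hcC, fun x hx y hy hxy => ?_⟩
  rcases Finset.mem_union.1 hx.1 with h | h
  · exact h₂ x h y hy.1 hxy.symm
  · exact h₁ x h y hy.1 hxy.symm

/-- A chordal graph has a perfect elimination ordering. -/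
theorem exists_elimination_order [Finite V] (hch : IsChordal H) :
    ∃ f : V → ℕ, f.Injective ∧ ∀ v, H.IsClique {u | H.Adj u v ∧ f u < f v} := by
  classical
  have : Fintype V := Fintype.ofFinite V
  suffices key : ∀ W : Finset V, ∃ f : V → ℕ, Set.InjOn f W ∧
      ∀ v ∈ W, H.IsClique {u | u ∈ W ∧ H.Adj u v ∧ f u < f v} by
    obtain ⟨f, hf, h⟩ := key Finset.univ
    exact ⟨f, by simpa using hf, fun v => by simpa using h v (Finset.mem_univ v)⟩
  intro W
  induction W using Finset.strongInduction with
  | H W ih =>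
  rcases W.eq_empty_or_nonempty with rfl | ⟨a, ha⟩
  · exact ⟨fun _ => 0, by simp, by simp⟩
  obtain ⟨v, hv, hcl⟩ : ∃ v ∈ W, H.IsClique {u | u ∈ W ∧ H.Adj v u} := by
    by_cases h : ∃ x ∈ W, ∃ c ∈ W, c ≠ x ∧ ¬H.Adj x c
    · obtain ⟨x, hx, hc⟩ := h
      obtain ⟨v, hv, -, -, hcl⟩ := exists_simplicial hch W x hx hc
      exact ⟨v, hv, hcl⟩
    · push Not at h
      exact ⟨a, ha, fun x hx y hy hxy => h x hx.1 y hy.1 hxy.symm⟩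
  obtain ⟨f, hf, h⟩ := ih _ (Finset.erase_ssubset hv)
  have hlt {u : V} (hu : u ∈ W.erase v) : f u < (W.erase v).sup f + 1 :=
    Nat.lt_succ_of_le (Finset.le_sup hu)
  refine ⟨Function.update f v ((W.erase v).sup f + 1), ?_, fun w hw => ?_⟩
  · intro x hx y hy hxy
    by_cases hxv : x = v <;> by_cases hyv : y = v
    · rw [hxv, hyv]
    · have := hlt (Finset.mem_erase.2 ⟨hyv, hy⟩)
      rw [hxv, Function.update_self, Function.update_of_ne hyv] at hxy
      omega
    · have := hlt (Finset.mem_erase.2 ⟨hxv, hx⟩)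
      rw [hyv, Function.update_self, Function.update_of_ne hxv] at hxy
      omega
    · rw [Function.update_of_ne hxv, Function.update_of_ne hyv] at hxy
      exact hf (Finset.mem_coe.2 (Finset.mem_erase.2 ⟨hxv, hx⟩))
        (Finset.mem_coe.2 (Finset.mem_erase.2 ⟨hyv, hy⟩)) hxy
  · by_cases hwv : w = v
    · subst hwv
      exact fun x hx y hy => hcl ⟨hx.1, hx.2.1.symm⟩ ⟨hy.1, hy.2.1.symm⟩
    · have hw' := Finset.mem_erase.2 ⟨hwv, hw⟩
      refine (h w hw').subset fun u hu => ?_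
      obtain ⟨hu, huw, hlt'⟩ := hu
      rw [Function.update_of_ne hwv] at hlt'
      by_cases huv : u = v
      · have := hlt hw'
        rw [huv, Function.update_self] at hlt'
        omega
      · rw [Function.update_of_ne huv] at hlt'
        exact ⟨Finset.mem_erase.2 ⟨huv, hu⟩, huw, hlt'⟩

end Elimination

section Cells

variable {V : Type} {H : SimpleGraph V}

/-- `Q` is the vertex set of a complete subgraph on four vertices. -/
def IsK4 (H : SimpleGraph V) (Q : Set V) : Prop :=
  ∃ e : Fin 4 → V, (∀ a b, a ≠ b → H.Adj (e a) (e b)) ∧ Set.range e = Q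

/-- No two distinct vertices have three distinct common neighbors. -/
def FewCommon (H : SimpleGraph V) : Prop :=
  ∀ x y a b c, x ≠ y → a ≠ b → a ≠ c → b ≠ c → H.Adj x a → H.Adj x b → H.Adj x c →
    H.Adj y a → H.Adj y b → ¬H.Adj y c

theorem fewCommon_of_not_isMinor
    (h : ¬IsMinor (completeBipartiteGraph (Fin 2) (Fin 3)) H) : FewCommon H := by
  intro x y a b c hxy hab hac hbc hxa hxb hxc hya hyb hyc
  refine h ⟨fun w => {Sum.elim ![x, y] ![a, b, c] w}, fun _ => Set.singleton_nonempty _,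
    fun w w' hw => ?_, fun w => ?_, fun w w' hw => ⟨_, rfl, _, rfl, ?_⟩⟩
  · have hinj : (Sum.elim ![x, y] ![a, b, c]).Injective := by
      refine Function.Injective.sumElim ?_ ?_ ?_
      · simp [Function.Injective, Fin.forall_fin_succ, hxy, hxy.symm]
      · simp [Function.Injective, Fin.forall_fin_succ, hab, hac, hbc, hab.symm, hac.symm,
          hbc.symm]
      · simp [Fin.forall_fin_succ, hxa.ne, hxb.ne, hxc.ne, hya.ne, hyb.ne, hyc.ne]
    exact Set.disjoint_singleton.2 (hinj.ne hw)
  · exact SimpleGraph.Connected.mk (SimpleGraph.Preconnected.of_subsingleton)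
  · have key : ∀ (i : Fin 2) (j : Fin 3), H.Adj (![x, y] i) (![a, b, c] j) := by
      simp [Fin.forall_fin_succ, *]
    rcases w with i | j <;> rcases w' with i' | j' <;> simp at hw
    · exact key i j'
    · exact (key i' j).symm

theorem IsK4.adj {Q : Set V} (hQ : IsK4 H Q) {u v : V} (hu : u ∈ Q) (hv : v ∈ Q) (huv : u ≠ v) :
    H.Adj u v := by
  obtain ⟨e, he, rfl⟩ := hQ
  obtain ⟨i, rfl⟩ := hu
  obtain ⟨j, rfl⟩ := hv
  exact he i j fun h => huv (congrArg e h)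

theorem isK4_of_adj {a b c d : V} (hab : H.Adj a b) (hac : H.Adj a c) (had : H.Adj a d)
    (hbc : H.Adj b c) (hbd : H.Adj b d) (hcd : H.Adj c d) : IsK4 H {a, b, c, d} := by
  refine ⟨![a, b, c, d], ?_, ?_⟩
  swap
  · ext x
    simp only [Matrix.range_cons, Matrix.range_empty, Set.mem_union, Set.mem_singleton_iff,
      Set.mem_insert_iff, Set.mem_empty_iff_false, or_false]
  simp [Fin.forall_fin_succ, *, hab.symm, hac.symm, had.symm, hbc.symm, hbd.symm, hcd.symm]

theorem IsK4.mem_of_adj (hF : FewCommon H) {Q : Set V} (hQ : IsK4 H Q) {u v w : V} (hu : u ∈ Q)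
    (hv : v ∈ Q) (huv : u ≠ v) (huw : H.Adj u w) (hvw : H.Adj v w) : w ∈ Q := by
  obtain ⟨e, he, rfl⟩ := hQ
  obtain ⟨i, rfl⟩ := hu
  obtain ⟨j, rfl⟩ := hv
  have key : ∀ i j : Fin 4, ∃ k l : Fin 4, k ≠ l ∧ i ≠ k ∧ i ≠ l ∧ j ≠ k ∧ j ≠ l := by decide
  obtain ⟨k, l, hkl, hik, hil, hjk, hjl⟩ := key i j
  by_contra hw
  refine hF (e i) (e j) (e k) (e l) w huv (he _ _ hkl).ne ?_ ?_ (he _ _ hik) (he _ _ hil) huw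
    (he _ _ hjk) (he _ _ hjl) hvw
  · rintro rfl; exact hw ⟨k, rfl⟩
  · rintro rfl; exact hw ⟨l, rfl⟩

theorem IsK4.mem_of_pairwise (hF : FewCommon H) {Q K : Set V} (hQ : IsK4 H Q) (hK : H.IsClique K)
    {u v : V} (hu : u ∈ Q) (hv : v ∈ Q) (huv : u ≠ v) (huK : u ∈ K) (hvK : v ∈ K) : K ⊆ Q := by
  intro w hw
  by_cases h₁ : u = w
  · exact h₁ ▸ hu
  by_cases h₂ : v = w
  · exact h₂ ▸ hv
  exact hQ.mem_of_adj hF hu hv huv (hK huK hw h₁) (hK hvK hw h₂)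

theorem IsK4.isClique {Q : Set V} (hQ : IsK4 H Q) : H.IsClique Q :=
  fun _ hu _ hv huv => hQ.adj hu hv huv

/-- An edge is free if it lies in no complete subgraph on four vertices. -/
def Free (H : SimpleGraph V) (u v : V) : Prop := ∀ Q, IsK4 H Q → ¬(u ∈ Q ∧ v ∈ Q)

theorem Free.symm {u v : V} (h : Free H u v) : Free H v u := fun Q hQ h' => h Q hQ h'.symm

/-- Vertices, free edges inside of `N`, and traces on `N` of complete subgraphs on four
vertices. -/
def cells (H : SimpleGraph V) (N : Set V) : Set (Set V) :=
  {C | (∃ v, C = {v}) ∨ (∃ u v, (inside H N).Adj u v ∧ Free H u v ∧ C = {u, v}) ∨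
    ∃ Q, IsK4 H Q ∧ C = Q ∩ N}

variable {N : Set V} {f : V → ℕ}

theorem singleton_mem_cells (v : V) : {v} ∈ cells H N := .inl ⟨v, rfl⟩

theorem pair_mem_cells {u v : V} (h : (inside H N).Adj u v) (hf : Free H u v) :
    {u, v} ∈ cells H N := .inr (.inl ⟨u, v, h, hf, rfl⟩)

theorem inter_mem_cells {Q : Set V} (hQ : IsK4 H Q) : Q ∩ N ∈ cells H N :=
  .inr (.inr ⟨Q, hQ, rfl⟩)

theorem adj_of_mem_cells {C : Set V} (hC : C ∈ cells H N) {u v : V} (hu : u ∈ C) (hv : v ∈ C)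
    (huv : u ≠ v) : (inside H N).Adj u v := by
  rcases hC with ⟨w, rfl⟩ | ⟨a, b, hab, -, rfl⟩ | ⟨Q, hQ, rfl⟩
  · exact absurd (hu.trans hv.symm) huv
  · rcases hu with rfl | rfl <;> rcases hv with rfl | rfl
    · exact absurd rfl huv
    · exact hab
    · exact hab.symm
    · exact absurd rfl huv
  · exact ⟨hQ.adj hu.1 hv.1 huv, hu.2, hv.2⟩

theorem eq_of_mem_pair {a b u v : V} (hu : u ∈ ({a, b} : Set V)) (hv : v ∈ ({a, b} : Set V))
    (huv : u ≠ v) : ({a, b} : Set V) = {u, v} := by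
  rcases hu with rfl | rfl <;> rcases hv with rfl | rfl
  · exact absurd rfl huv
  · rfl
  · exact Set.pair_comm _ _
  · exact absurd rfl huv

theorem subsingleton_inter_of_mem_cells (hF : FewCommon H) {C D : Set V} (hC : C ∈ cells H N)
    (hD : D ∈ cells H N) (hCD : C ≠ D) : (C ∩ D).Subsingleton := by
  rintro u ⟨huC, huD⟩ v ⟨hvC, hvD⟩
  by_contra huv
  rcases hC with ⟨w, rfl⟩ | ⟨a, b, hab, hfree, rfl⟩ | ⟨Q, hQ, rfl⟩
  · exact huv (huC.trans hvC.symm)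
  · have h₁ := eq_of_mem_pair huC hvC huv
    rcases hD with ⟨w, rfl⟩ | ⟨a', b', -, -, rfl⟩ | ⟨Q, hQ, rfl⟩
    · exact huv (huD.trans hvD.symm)
    · exact hCD (h₁.trans (eq_of_mem_pair huD hvD huv).symm)
    · have ha : a ∈ ({u, v} : Set V) := h₁ ▸ by simp
      have hb : b ∈ ({u, v} : Set V) := h₁ ▸ by simp
      have hsub : ({u, v} : Set V) ⊆ Q := by
        rintro w (rfl | rfl)
        · exact huD.1
        · exact hvD.1
      exact hfree Q hQ ⟨hsub ha, hsub hb⟩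
  · rcases hD with ⟨w, rfl⟩ | ⟨a, b, hab, hfree, rfl⟩ | ⟨Q', hQ', rfl⟩
    · exact huv (huD.trans hvD.symm)
    · have h₁ := eq_of_mem_pair huD hvD huv
      have ha : a ∈ ({u, v} : Set V) := h₁ ▸ by simp
      have hb : b ∈ ({u, v} : Set V) := h₁ ▸ by simp
      have hsub : ({u, v} : Set V) ⊆ Q := by
        rintro w (rfl | rfl)
        · exact huC.1
        · exact hvC.1
      exact hfree Q hQ ⟨hsub ha, hsub hb⟩
    · have h₁ := hQ.mem_of_pairwise hF hQ'.isClique huC.1 hvC.1 huv huD.1 hvD.1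
      have h₂ := hQ'.mem_of_pairwise hF hQ.isClique huD.1 hvD.1 huv huC.1 hvC.1
      exact hCD (by rw [h₁.antisymm h₂])

/-- The neighbors of `v` inside of `N` preceding it in the order given by `f`. -/
def parents (H : SimpleGraph V) (f : V → ℕ) (N : Set V) (v : V) : Set V :=
  {u | (inside H N).Adj u v ∧ f u < f v}

theorem cell_or_triangle (hF : FewCommon H)
    (hcl : ∀ v, H.IsClique {u | H.Adj u v ∧ f u < f v}) (v : V)
    (hv : (parents H f N v).Nonempty) :
    (∃ C ∈ cells H N, v ∈ C ∧ parents H f N v ⊆ C) ∨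
      ∃ a b, a ≠ b ∧ parents H f N v = {a, b} ∧ (inside H N).Adj a b ∧ (inside H N).Adj a v ∧
        (inside H N).Adj b v ∧ Free H a b ∧ Free H a v ∧ Free H b v := by
  have hK : H.IsClique (insert v (parents H f N v)) := by
    have h : H.IsClique (parents H f N v) := fun x hx y hy hxy =>
      hcl v ⟨hx.1.1, hx.2⟩ ⟨hy.1.1, hy.2⟩ hxy
    exact h.insert fun u hu _ => hu.1.1.symm
  have hvN : v ∈ N := by
    obtain ⟨a, ha⟩ := hv
    exact ha.1.2.2
  by_cases h : ∃ Q, IsK4 H Q ∧ ∃ u ∈ Q, ∃ w ∈ Q, u ≠ w ∧ u ∈ insert v (parents H f N v) ∧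
      w ∈ insert v (parents H f N v)
  · obtain ⟨Q, hQ, u, hu, w, hw, huw, hu', hw'⟩ := h
    have hsub := hQ.mem_of_pairwise hF hK hu hw huw hu' hw'
    exact .inl ⟨Q ∩ N, inter_mem_cells hQ, ⟨hsub (by simp), hvN⟩,
      fun x hx => ⟨hsub (by simp [hx]), hx.1.2.1⟩⟩
  · have hfree {x y : V} (hx : x ∈ insert v (parents H f N v))
        (hy : y ∈ insert v (parents H f N v)) (hxy : x ≠ y) : Free H x y :=
      fun Q hQ h' => h ⟨Q, hQ, x, h'.1, y, h'.2, hxy, hx, hy⟩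
    obtain ⟨a, ha⟩ := hv
    by_cases hb : ∃ b ∈ parents H f N v, b ≠ a
    · obtain ⟨b, hb, hba⟩ := hb
      have hab : H.Adj a b := hK (by simp [ha]) (by simp [hb]) hba.symm
      refine .inr ⟨a, b, hba.symm, ?_, ⟨hab, ha.1.2.1, hb.1.2.1⟩, ha.1, hb.1,
        hfree (by simp [ha]) (by simp [hb]) hba.symm, hfree (by simp [ha]) (by simp) ha.1.ne,
        hfree (by simp [hb]) (by simp) hb.1.ne⟩
      refine Set.Subset.antisymm (fun c hc => ?_) ?_
      · by_contra hne
        have hca : a ≠ c := fun h' => hne (by simp [h'])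
        have hcb : b ≠ c := fun h' => hne (by simp [h'])
        exact hfree (by simp [ha]) (by simp [hb]) hba.symm _
          (isK4_of_adj hab (hK (by simp [ha]) (by simp [hc]) hca) ha.1.1
            (hK (by simp [hb]) (by simp [hc]) hcb) hb.1.1 hc.1.1) (by simp)
      · rintro c (rfl | rfl)
        · exact ha
        · exact hb
    · push Not at hb
      exact .inl ⟨{a, v}, pair_mem_cells ha.1 (hfree (by simp [ha]) (by simp) ha.1.ne), by simp,
        fun x hx => by simp [hb x hx]⟩

theorem cliqueLegal_pair_of_cells [DecidableEq V] {s : V → Fin 5} {L : List (Move V)}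
    (h : ∀ C ∈ cells H N, CliqueLegal C s (res C L)) {u v : V} (huv : (inside H N).Adj u v) :
    CliqueLegal {u, v} s (res {u, v} L) := by
  by_cases hf : Free H u v
  · exact h _ (pair_mem_cells huv hf)
  · simp only [Free, not_forall, not_not] at hf
    obtain ⟨Q, hQ, hu, hv⟩ := hf
    have hsub : ({u, v} : Set V) ⊆ Q ∩ N := by
      rintro w (rfl | rfl)
      · exact ⟨hu, huv.2.1⟩
      · exact ⟨hv, huv.2.2⟩
    have := (h _ (inter_mem_cells hQ)).res hsub
    rwa [res_res, Set.inter_eq_left.2 hsub] at this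

/-- The greedy independent set of an ordered graph. -/
theorem exists_greedy (H : SimpleGraph V) (hf : f.Injective) : ∃ I : V → Bool,
    (∀ u v, H.Adj u v → ¬(I u = true ∧ I v = true)) ∧
      ∀ v, I v = false → ∃ u, H.Adj u v ∧ f u < f v ∧ I u = true := by
  classical
  let I : V → Bool := WellFounded.fix (measure f).wf fun v rec =>
    decide (∀ u (h : f u < f v), H.Adj u v → rec u h = false)
  have hI (v : V) : I v = true ↔ ∀ u, f u < f v → H.Adj u v → I u = false := by
    have := WellFounded.fix_eq (measure f).wf (C := fun _ => Bool)
      (fun v rec => decide (∀ u (h : f u < f v), H.Adj u v → rec u h = false)) v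
    change I v = _ at this
    rw [this, decide_eq_true_eq]
  refine ⟨I, fun u v huv h => ?_, fun v hv => ?_⟩
  · rcases lt_trichotomy (f u) (f v) with hlt | heq | hlt
    · exact Bool.false_ne_true (((hI v).1 h.2 u hlt huv).symm.trans h.1)
    · exact huv.ne (hf heq)
    · exact Bool.false_ne_true (((hI u).1 h.1 v hlt huv.symm).symm.trans h.2)
  · by_contra! hne
    have := (hI v).2 fun u hu huv => by simpa using hne u huv hu
    rw [this] at hv
    cases hv

/-- A complete subgraph on four vertices has exactly one vertex in the greedy independent set. -/
theorem exists_eq_decide (hF : FewCommon H) (hf : f.Injective)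
    (hcl : ∀ v, H.IsClique {u | H.Adj u v ∧ f u < f v}) {I : V → Bool}
    (hI : ∀ u v, H.Adj u v → ¬(I u = true ∧ I v = true))
    (hI' : ∀ v, I v = false → ∃ u, H.Adj u v ∧ f u < f v ∧ I u = true) {e : Fin 4 → V}
    (he : ∀ a b, a ≠ b → H.Adj (e a) (e b)) : ∃ i, ∀ a, I (e a) = decide (a = i) := by
  have hQ : IsK4 H (Set.range e) := ⟨e, he, rfl⟩
  suffices h : ∃ i, I (e i) = true by
    obtain ⟨i, hi⟩ := h
    refine ⟨i, fun a => ?_⟩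
    by_cases ha : a = i
    · simp [ha, hi]
    · have := hI _ _ (he a i ha)
      simp [ha]
      simpa [hi] using this
  obtain ⟨t, ht⟩ := Finite.exists_max (f ∘ e)
  by_cases htI : I (e t) = true
  · exact ⟨t, htI⟩
  obtain ⟨u, hut, hlt, hu⟩ := hI' (e t) (by simpa using htI)
  obtain ⟨w, hw⟩ := exists_ne t
  have hwt := he w t hw
  have hlt' : f (e w) < f (e t) := lt_of_le_of_ne (ht w) (hf.ne hwt.ne)
  suffices h : u ∈ Set.range e by
    obtain ⟨i, rfl⟩ := h
    exact ⟨i, hu⟩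
  by_cases huw : e w = u
  · exact ⟨w, huw⟩
  · exact hQ.mem_of_adj hF ⟨w, rfl⟩ ⟨t, rfl⟩ hwt.ne (hcl (e t) ⟨hwt, hlt'⟩ ⟨hut, hlt⟩ huw) hut.symm

end Cells

section Phases

variable {V : Type} [Finite V] [DecidableEq V] {H : SimpleGraph V} {f : V → ℕ} {I : V → Bool}
  {α β : V → Fin 5}

/-- The first phase removes color `0` from all vertices outside of the greedy independent set. -/
theorem exists_reach_ne_zero (hF : FewCommon H) (hf : f.Injective)
    (hcl : ∀ v, H.IsClique {u | H.Adj u v ∧ f u < f v})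
    (hI : ∀ u v, H.Adj u v → ¬(I u = true ∧ I v = true))
    (hI' : ∀ v, I v = false → ∃ u, H.Adj u v ∧ f u < f v ∧ I u = true)
    (hα : IsProperColoring H α) :
    ∃ γ, Reach H 2 α γ ∧ ∀ v, I v = false → γ v ≠ 0 := by
  have hadj {u v : V} : (inside H Set.univ).Adj u v ↔ H.Adj u v := by simp [inside]
  obtain ⟨L, hL⟩ := exists_glued (f := f) (P := parents H f Set.univ)
    (cells := cells H Set.univ) (Ok := ClearOk I α)
    (VT := fun v τ => clearTrace (I v) (α v) τ = true ∧ CliqueLegal {v} α (movesOf v τ))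
    hf (fun u v h => h.2)
    (fun C hC u hu v hv h => ⟨adj_of_mem_cells hC hu hv fun h' => h.ne (congrArg f h'), h⟩)
    (fun C hC D hD hne => subsingleton_inter_of_mem_cells hF hC hD hne)
    (by
      rintro C (⟨v, rfl⟩ | ⟨u, v, -, -, rfl⟩ | ⟨Q, ⟨e, -, rfl⟩, rfl⟩)
      · simp
      · simp
      · exact ⟨e 0, ⟨0, rfl⟩, trivial⟩)
    (fun C R h => h.1)
    (fun C R h v hv => ⟨h.2.2.1 v hv, h.2.1.movesOf_trace hv⟩)
    (by
      rintro C (⟨w, rfl⟩ | ⟨u, w, huw, -, rfl⟩ | ⟨Q, ⟨e, he, rfl⟩, rfl⟩) v hv τ ⟨hτ, hl⟩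
      · obtain rfl : v = w := hv
        exact exists_clearOk_singleton hτ hl
      · rcases hv with rfl | rfl
        · exact exists_clearOk_pair huw.ne (hα huw.1) (hI _ _ huw.1) hτ hl
        · rw [Set.pair_comm]
          exact exists_clearOk_pair huw.ne' (hα huw.1.symm) (hI _ _ huw.1.symm) hτ hl
      · obtain ⟨i, hi⟩ := exists_eq_decide hF hf hcl hI hI' he
        have hinj : (α ∘ e).Injective := fun a b hab => by
          by_contra hne
          exact hα (he a b hne) hab
        rw [Set.inter_univ] at hv ⊢
        exact exists_clearOk_four hinj.of_comp hinj hi hv hτ hl)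
    (by
      intro v
      by_cases h : α v = 0
      · exact ⟨[1], by simp [clearTrace], by simp [movesOf, CliqueLegal, h]⟩
      · exact ⟨[], by simp [clearTrace, h], by simp [movesOf, CliqueLegal]⟩)
    (by
      intro v hv
      rcases cell_or_triangle hF hcl v hv with h | ⟨a, b, hab, hP, aab, aav, abv, fab, fav, fbv⟩
      · exact .inl h
      refine .inr ⟨a, b, hab, hP, pair_mem_cells aab fab, pair_mem_cells aav fav,
        pair_mem_cells abv fbv, fun R₀ hR₀ => ?_⟩
      simp only [← filter_ne_eq_res]
      refine exists_triangle_extension hab aav.ne abv.ne (hα aab.1) (hα aav.1) (hα abv.1) ?_ hR₀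
      have h₁ := hI _ _ aab.1
      have h₂ := hI _ _ aav.1
      have h₃ := hI _ _ abv.1
      have h₄ : I v = false → I a = true ∨ I b = true := fun hv' => by
        obtain ⟨u, huv, hlt, hu⟩ := hI' v hv'
        have : u ∈ parents H f Set.univ v := ⟨hadj.2 huv, hlt⟩
        rw [hP] at this
        rcases this with rfl | rfl
        · exact .inl hu
        · exact .inr hu
      revert h₁ h₂ h₃ h₄
      cases I a <;> cases I b <;> cases I v <;> simp)
  have hc (C) (hC : C ∈ cells H Set.univ) : CliqueLegal C α (res C L) := (hL C hC).2.1
  have ht (v : V) : clearTrace (I v) (α v) (trace v L) = true := by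
    have := (hL _ (singleton_mem_cells v)).2.2.1 v rfl
    rwa [trace_res (Set.mem_singleton v)] at this
  refine ⟨run α L, ⟨L, legal_of_cliqueLegal (fun v => hc _ (singleton_mem_cells v))
    fun u v huv => cliqueLegal_pair_of_cells hc (hadj.2 huv), rfl,
    fun v => clearTrace_length (ht v)⟩, fun v hv => ?_⟩
  have := ht v
  rw [run_apply]
  simp only [clearTrace, hv, Bool.false_or, Bool.and_eq_true, Bool.not_eq_true',
    decide_eq_false_iff_not] at this
  exact this.2

/-- In the last phase, only vertices outside of the greedy independent set are recolored. -/
theorem reach_of_eq_zero_iff (hF : FewCommon H) (hf : f.Injective)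
    (hcl : ∀ v, H.IsClique {u | H.Adj u v ∧ f u < f v})
    (hI : ∀ u v, H.Adj u v → ¬(I u = true ∧ I v = true))
    (hI' : ∀ v, I v = false → ∃ u, H.Adj u v ∧ f u < f v ∧ I u = true)
    (hα : IsProperColoring H α) (hβ : IsProperColoring H β)
    (hα0 : ∀ v, α v = 0 ↔ I v = true) (hβ0 : ∀ v, β v = 0 ↔ I v = true) :
    Reach H 3 α β := by
  set N : Set V := {v | I v = false} with hN
  have hα0' {v : V} (hv : I v = false) : α v ≠ 0 := fun h => by simp [(hα0 v).1 h] at hv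
  have hβ0' {v : V} (hv : I v = false) : β v ≠ 0 := fun h => by simp [(hβ0 v).1 h] at hv
  have hQ {Q : Set V} (h : IsK4 H Q) : ∃ e : Fin 3 → V, (∀ a b, a ≠ b → H.Adj (e a) (e b)) ∧
      (∀ a, I (e a) = false) ∧ Q ∩ N = Set.range e := by
    obtain ⟨e, he, rfl⟩ := h
    obtain ⟨i, hi⟩ := exists_eq_decide hF hf hcl hI hI' he
    refine ⟨e ∘ i.succAbove, fun a b hab => he _ _ fun h => hab (Fin.succAbove_right_injective h),
      fun a => by simp [hi, Fin.succAbove_ne], ?_⟩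
    ext v
    constructor
    · rintro ⟨⟨j, rfl⟩, hj⟩
      have : j ≠ i := by
        rintro rfl
        simp [hN, hi] at hj
      obtain ⟨k, rfl⟩ := Fin.exists_succAbove_eq this
      exact ⟨k, rfl⟩
    · rintro ⟨k, rfl⟩
      exact ⟨⟨_, rfl⟩, by simp [hN, hi, Fin.succAbove_ne]⟩
  obtain ⟨L, hL⟩ := exists_glued (f := f) (P := parents H f N)
    (cells := cells H N) (Ok := FixOk I α β)
    (VT := fun v τ => fixTrace (I v) (α v) (β v) τ = true ∧ CliqueLegal {v} α (movesOf v τ))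
    hf (fun u v h => h.2)
    (fun C hC u hu v hv h => ⟨adj_of_mem_cells hC hu hv fun h' => h.ne (congrArg f h'), h⟩)
    (fun C hC D hD hne => subsingleton_inter_of_mem_cells hF hC hD hne)
    (by
      rintro C (⟨v, rfl⟩ | ⟨u, v, -, -, rfl⟩ | ⟨Q, h, rfl⟩)
      · simp
      · simp
      · obtain ⟨e, -, -, he⟩ := hQ h
        exact he ▸ Set.range_nonempty e)
    (fun C R h => h.1)
    (fun C R h v hv => ⟨h.2.2 v hv, h.2.1.movesOf_trace hv⟩)
    (by
      rintro C (⟨w, rfl⟩ | ⟨u, w, huw, -, rfl⟩ | ⟨Q, h, rfl⟩) v hv τ ⟨hτ, hl⟩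
      · obtain rfl : v = w := hv
        exact exists_fixOk_singleton hτ hl
      · obtain ⟨huw, hu, hw⟩ := huw
        rcases hv with rfl | rfl
        · exact exists_fixOk_pair huw.ne (hα huw) (hβ huw) ⟨hu, hw⟩ ⟨hα0' hu, hα0' hw⟩
            ⟨hβ0' hu, hβ0' hw⟩ hτ hl
        · rw [Set.pair_comm]
          exact exists_fixOk_pair huw.ne' (hα huw.symm) (hβ huw.symm) ⟨hw, hu⟩
            ⟨hα0' hw, hα0' hu⟩ ⟨hβ0' hw, hβ0' hu⟩ hτ hl
      · obtain ⟨e, he, heI, hr⟩ := hQ h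
        have hinj {γ : V → Fin 5} (hγ : IsProperColoring H γ) : (γ ∘ e).Injective :=
          fun a b hab => by
            by_contra hne
            exact hγ (he a b hne) hab
        rw [hr] at hv ⊢
        exact exists_fixOk_triple (hinj hα).of_comp (hinj hα) (hinj hβ) heI
          (fun a => hα0' (heI a)) (fun a => hβ0' (heI a)) hv hτ hl)
    (by
      intro v
      by_cases hv : I v = true
      · exact ⟨[], by simp [fixTrace, hv], by simp [movesOf, CliqueLegal]⟩
      rw [Bool.not_eq_true] at hv
      by_cases h : α v = β v
      · exact ⟨[], by simp [fixTrace, hv, h], by simp [movesOf, CliqueLegal]⟩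
      · exact ⟨[β v], by simp [fixTrace, hv, (hβ0' hv).symm],
          by simp [movesOf, CliqueLegal, h]⟩)
    (by
      intro v hv
      rcases cell_or_triangle hF hcl v hv with h | ⟨a, b, hab, hP, aab, aav, abv, fab, -, -⟩
      · exact .inl h
      obtain ⟨u, huv, hlt, hu⟩ := hI' v aav.2.2
      have hne {x : V} (hx : x ∈ N) : x ≠ u := by
        rintro rfl
        exact Bool.false_ne_true (hx.symm.trans hu)
      have hav : f a < f v := (show a ∈ parents H f N v by simp [hP]).2
      have hbv : f b < f v := (show b ∈ parents H f N v by simp [hP]).2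
      exact absurd (by simp) (fab _ (isK4_of_adj aab.1
        (hcl v ⟨aav.1, hav⟩ ⟨huv, hlt⟩ (hne aav.2.1)) aav.1
        (hcl v ⟨abv.1, hbv⟩ ⟨huv, hlt⟩ (hne abv.2.1)) abv.1 huv)))
  have hc (C) (hC : C ∈ cells H N) : CliqueLegal C α (res C L) := (hL C hC).2.1
  have ht (v : V) : fixTrace (I v) (α v) (β v) (trace v L) = true := by
    have := (hL _ (singleton_mem_cells v)).2.2 v rfl
    rwa [trace_res (Set.mem_singleton v)] at this
  have hmem {m : Move V} (hm : m ∈ L) : I m.1 = false ∧ m.2 ≠ 0 := by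
    have hm' : m.2 ∈ trace m.1 L := List.mem_map.2 ⟨m, by simpa using hm, rfl⟩
    have := ht m.1
    unfold fixTrace at this
    split at this
    · rw [List.isEmpty_iff.1 this] at hm'
      simp at hm'
    · next h =>
      refine ⟨by simpa using h, fun h0 => ?_⟩
      rw [h0] at hm'
      simp [hm'] at this
  have hz {u v : V} (huv : H.Adj u v) (hu : I u = true) : CliqueLegal {u, v} α (res {u, v} L) := by
    have hv : I v = false := by simpa [hu] using hI u v huv
    have hne {m : Move V} (hm : m ∈ L) : m.1 ≠ u := fun h => by simp [← h, (hmem hm).1] at hu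
    rw [res_congr (D := {v}) fun m hm => by simp [hne hm]]
    refine (hc _ (singleton_mem_cells v)).insert_of_forall_ne fun m hm => ?_
    have hm := (mem_res.1 hm).1
    exact ⟨hne hm, by rw [(hα0 u).2 hu]; exact (hmem hm).2⟩
  refine ⟨L, legal_of_cliqueLegal (fun v => hc _ (singleton_mem_cells v)) fun u v huv => ?_,
    ?_, fun v => fixTrace_length (ht v)⟩
  · by_cases hu : I u = true
    · exact hz huv hu
    by_cases hv : I v = true
    · rw [Set.pair_comm]
      exact hz huv.symm hv
    · exact cliqueLegal_pair_of_cells hc ⟨huv, Bool.eq_false_of_not_eq_true hu,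
        Bool.eq_false_of_not_eq_true hv⟩
  · ext1 v
    have := ht v
    rw [run_apply]
    unfold fixTrace at this
    split at this
    · next h => rw [List.isEmpty_iff.1 this, List.getLastD_nil, (hα0 v).2 h, (hβ0 v).2 h]
    · simp only [Bool.and_eq_true, decide_eq_true_eq] at this
      exact this.2

/-- Two proper colorings with five colors can be joined by recoloring each vertex at most nine
times. -/
theorem reach_nine (hF : FewCommon H) (hf : f.Injective)
    (hcl : ∀ v, H.IsClique {u | H.Adj u v ∧ f u < f v})
    (hα : IsProperColoring H α) (hβ : IsProperColoring H β) : Reach H 9 α β := by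
  obtain ⟨I, hI, hI'⟩ := exists_greedy H hf
  have key {γ : V → Fin 5} (hγ : IsProperColoring H γ) :
      ∃ δ, Reach H (2 + 1) γ δ ∧ ∀ v, δ v = 0 ↔ I v = true := by
    obtain ⟨δ, hδ, h0⟩ := exists_reach_ne_zero hF hf hcl hI hI' hγ
    refine ⟨_, hδ.trans (reach_zero hI h0), fun v => ?_⟩
    by_cases hv : I v = true
    · simp [hv]
    · rw [Bool.not_eq_true] at hv
      simp [hv, h0 v hv]
  obtain ⟨α', hα', hα0⟩ := key hα
  obtain ⟨β', hβ', hβ0⟩ := key hβ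
  exact (hα'.trans (reach_of_eq_zero_iff hF hf hcl hI hI' (hα'.isProperColoring hα)
    (hβ'.isProperColoring hβ) hα0 hβ0)).trans (hβ'.symm hβ)

end Phases

end Recoloring

theorem chordal_k23_minor_free_recolor_five_colors
    {V : Type} [Fintype V] (H : SimpleGraph V)
    (hch : IsChordal H)
    (h23 : ¬ IsMinor (completeBipartiteGraph (Fin 2) (Fin 3)) H)
    (α β : V → Fin 5)
    (hα : IsProperColoring H α) (hβ : IsProperColoring H β) :
    ∃ (m : ℕ) (c : Fin (m + 1) → V → Fin 5),
      IsTransformSeq H c α β ∧ ∀ v : V, RecolorCount c v ≤ 692 := by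
  classical
  obtain ⟨f, hf, hcl⟩ := Recoloring.exists_elimination_order hch
  obtain ⟨m, c, hc, h⟩ := (Recoloring.reach_nine
    (Recoloring.fewCommon_of_not_isMinor h23) hf hcl hα hβ).exists_isTransformSeq hα
  exact ⟨m, c, hc, fun v => (h v).trans (by norm_num)⟩
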